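/- arXiv:2405.09489 — 3 statements merged into one kernel-verified Lean document; each statement's English description precedes it below -/
import Mathlib

section
/- Let p = p(n) and d = d(n) be sequences with p(n) ≥ (d(n)+1)·ln(n)/n for all n, and for each n let G ~ G_{n,p(n),d(n)} be any d(n)-dependent random graph distribution on n vertices. Then the probability that every vertex of G has degree between n·p − 4√(n·p·(d+1)·ln(n)) and n·p + 4√(n·p·(d+1)·ln(n)) tends to 1 as n → ∞. -/
open MeasureTheory ProbabilityTheory Filter

abbrev EdgeIdx (n : ℕ) := {e : Sym2 (Fin n) // ¬ e.IsDiag}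

structure DepRandomGraph (n : ℕ) (p : ℝ) (d : ℕ) where
  Ω : Type
  m : MeasurableSpace Ω
  μ : @MeasureTheory.Measure Ω m
  isProb : @MeasureTheory.IsProbabilityMeasure Ω m μ
  X : EdgeIdx n → Ω → Bool
  meas : ∀ e, @Measurable Ω Bool m ⊤ (X e)
  probX : ∀ e, μ {ω | X e ω = true} = ENNReal.ofReal p
  D : SimpleGraph (EdgeIdx n)
  degBound : ∀ e, (D.neighborSet e).ncard ≤ d
  indep : ∀ e, @ProbabilityTheory.Indep Ω
      (MeasurableSpace.comap (X e) ⊤)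
      (⨆ f ∈ {f : EdgeIdx n | f ≠ e ∧ ¬ D.Adj e f}, MeasurableSpace.comap (X f) ⊤)
      m μ

attribute [instance] DepRandomGraph.m DepRandomGraph.isProb

def DepRandomGraph.graph {n : ℕ} {p : ℝ} {d : ℕ} (G : DepRandomGraph n p d) (ω : G.Ω) :
    SimpleGraph (Fin n) :=
  SimpleGraph.fromEdgeSet {e : Sym2 (Fin n) | ∃ h : ¬ e.IsDiag, G.X ⟨e, h⟩ ω = true}

noncomputable def DepRandomGraph.deg {n : ℕ} {p : ℝ} {d : ℕ} (G : DepRandomGraph n p d)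
    (ω : G.Ω) (v : Fin n) : ℕ :=
  {u | (G.graph ω).Adj v u}.ncard

noncomputable def DepRandomGraph.eAB {n : ℕ} {p : ℝ} {d : ℕ} (G : DepRandomGraph n p d)
    (ω : G.Ω) (A B : Finset (Fin n)) : ℕ :=
  {q : Fin n × Fin n | q.1 ∈ A ∧ q.2 ∈ B ∧ (G.graph ω).Adj q.1 q.2}.ncard

def ContainsCopy {n : ℕ} {α : Type*} (G' : SimpleGraph (Fin n)) (H : SimpleGraph α) : Prop :=
  ∃ f : α → Fin n, Function.Injective f ∧ ∀ u v, H.Adj u v → G'.Adj (f u) (f v)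

/-- The number of vertices covered by a finite set of edges. -/
noncomputable def edgeVertCount {α : Type*} (Γ : Finset (Sym2 α)) : ℕ :=
  {v : α | ∃ e ∈ Γ, v ∈ e}.ncard

/-- The edge cover number of a finite set of edges: the minimum size of a subset `A ⊆ Γ`
such that every edge of `Γ` shares an endpoint with some edge of `A`. -/
noncomputable def coverNum {α : Type*} (Γ : Finset (Sym2 α)) : ℕ :=
  sInf {k : ℕ | ∃ A ⊆ Γ, A.card = k ∧ ∀ e ∈ Γ, ∃ a ∈ A, ∃ v : α, v ∈ e ∧ v ∈ a}

lemma SimpleGraph.exists_coloring_on_of_ncard_le {V : Type*} [Finite V] (D : SimpleGraph V) (d : ℕ)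
    (hD : ∀ e, (D.neighborSet e).ncard ≤ d) (T : Finset V) :
    ∃ c : V → Fin (d + 1), ∀ e ∈ T, ∀ f ∈ T, D.Adj e f → c e ≠ c f := by
  classical
  induction T using Finset.induction_on with
  | empty => exact ⟨fun _ => 0, by simp⟩
  | insert a T ha ih =>
    obtain ⟨c, hc⟩ := ih
    obtain ⟨j, hj⟩ : ∃ j : Fin (d + 1), j ∉ c '' D.neighborSet a := by
      by_contra! h
      have h1 : (c '' D.neighborSet a) = Set.univ := Set.eq_univ_of_forall h
      have h2 := (Set.ncard_image_le (f := c) (Set.toFinite (D.neighborSet a))).trans (hD a)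
      rw [h1, Set.ncard_univ, Nat.card_eq_fintype_card, Fintype.card_fin] at h2
      omega
    have hj' : ∀ f, D.Adj a f → c f ≠ j := fun f hf h => hj ⟨f, hf, h⟩
    refine ⟨Function.update c a j, fun e he f hf hef => ?_⟩
    rcases Finset.mem_insert.1 he with rfl | he <;> rcases Finset.mem_insert.1 hf with rfl | hf
    · exact absurd hef (D.irrefl)
    · rw [Function.update_self, Function.update_of_ne hef.ne']
      exact (hj' f hef).symm
    · rw [Function.update_self, Function.update_of_ne hef.ne]
      exact hj' e hef.symm
    · rw [Function.update_of_ne (ne_of_mem_of_not_mem he ha),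
        Function.update_of_ne (ne_of_mem_of_not_mem hf ha)]
      exact hc e he f hf hef

namespace DepRandomGraph

variable {n : ℕ} {p : ℝ} {d : ℕ}

/-- The `{0,1}`-valued real indicator of the presence of an edge. -/
def ind (G : DepRandomGraph n p d) (e : EdgeIdx n) (ω : G.Ω) : ℝ :=
  if G.X e ω = true then 1 else 0

lemma measurable_ind_comap (G : DepRandomGraph n p d) (e : EdgeIdx n) :
    Measurable[MeasurableSpace.comap (G.X e) ⊤] (G.ind e) :=
  (Measurable.of_discrete (f := fun b : Bool => if b = true then (1 : ℝ) else 0)).comp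
    (comap_measurable (G.X e))

lemma measurable_ind (G : DepRandomGraph n p d) (e : EdgeIdx n) : Measurable (G.ind e) :=
  (G.measurable_ind_comap e).mono (G.meas e).comap_le le_rfl

/-- The exponential weight `exp (x * (X_e - p))`. -/
noncomputable def expWeight (G : DepRandomGraph n p d) (x : ℝ) (e : EdgeIdx n) (ω : G.Ω) :
    ENNReal :=
  ENNReal.ofReal (Real.exp (x * (G.ind e ω - p)))

lemma measurable_expWeight_comap (G : DepRandomGraph n p d) (x : ℝ) (e : EdgeIdx n) :
    Measurable[MeasurableSpace.comap (G.X e) ⊤] (G.expWeight x e) :=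
  ENNReal.measurable_ofReal.comp (Real.measurable_exp.comp
    (((G.measurable_ind_comap e).sub_const p).const_mul x))

lemma measurable_expWeight (G : DepRandomGraph n p d) (x : ℝ) (e : EdgeIdx n) :
    Measurable (G.expWeight x e) :=
  (G.measurable_expWeight_comap x e).mono (G.meas e).comap_le le_rfl

lemma prod_expWeight (G : DepRandomGraph n p d) (x : ℝ) (T : Finset (EdgeIdx n)) (ω : G.Ω) :
    ∏ e ∈ T, G.expWeight x e ω =
      ENNReal.ofReal (Real.exp (x * (∑ e ∈ T, G.ind e ω - T.card * p))) := by
  simp only [expWeight]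
  rw [← ENNReal.ofReal_prod_of_nonneg (fun _ _ => (Real.exp_pos _).le), ← Real.exp_sum,
    ← Finset.mul_sum, Finset.sum_sub_distrib, Finset.sum_const, nsmul_eq_mul]

lemma prob_edge_le_one (G : DepRandomGraph n p d) (e : EdgeIdx n) : p ≤ 1 :=
  ENNReal.ofReal_le_one.1 (G.probX e ▸ prob_le_one)

lemma lintegral_expWeight_le (G : DepRandomGraph n p d) (hp0 : 0 ≤ p) {x : ℝ} (hx : |x| ≤ 1)
    (e : EdgeIdx n) :
    ∫⁻ ω, G.expWeight x e ω ∂G.μ ≤ ENNReal.ofReal (Real.exp (p * x ^ 2)) := by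
  have hA : MeasurableSet {ω | G.X e ω = true} := G.meas e (MeasurableSet.of_discrete (s := {true}))
  have hp1 : p ≤ 1 := G.prob_edge_le_one e
  have hfun : ∀ ω, G.expWeight x e ω =
      {ω | G.X e ω = true}.indicator (fun _ => ENNReal.ofReal (Real.exp (x * (1 - p)))) ω +
      {ω | G.X e ω = true}ᶜ.indicator (fun _ => ENNReal.ofReal (Real.exp (x * (0 - p)))) ω := by
    intro ω
    by_cases h : G.X e ω = true <;> simp [expWeight, ind, h]
  have hq : G.μ {ω | G.X e ω = true}ᶜ = ENNReal.ofReal (1 - p) := by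
    rw [prob_compl_eq_one_sub hA, G.probX, ENNReal.ofReal_sub _ hp0, ENNReal.ofReal_one]
  simp_rw [hfun]
  rw [lintegral_add_left (measurable_const.indicator hA), lintegral_indicator_const hA,
    lintegral_indicator_const hA.compl, G.probX, hq,
    ← ENNReal.ofReal_mul (Real.exp_pos _).le, ← ENNReal.ofReal_mul (Real.exp_pos _).le,
    ← ENNReal.ofReal_add (by positivity) (mul_nonneg (Real.exp_pos _).le (by linarith))]
  apply ENNReal.ofReal_le_ofReal
  have h1 : Real.exp x ≤ 1 + x + x ^ 2 := by
    have := (abs_le.1 (Real.abs_exp_sub_one_sub_id_le hx)).2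
    linarith
  have h2 : p * (Real.exp x - 1) + 1 ≤ Real.exp (p * (x + x ^ 2)) :=
    (add_le_add_left (mul_le_mul_of_nonneg_left (by linarith) hp0) 1).trans
      (Real.add_one_le_exp _)
  calc Real.exp (x * (1 - p)) * p + Real.exp (x * (0 - p)) * (1 - p)
      = Real.exp (x * (0 - p)) * (p * (Real.exp x - 1) + 1) := by
        rw [show x * (1 - p) = x * (0 - p) + x by ring, Real.exp_add]; ring
    _ ≤ Real.exp (x * (0 - p)) * Real.exp (p * (x + x ^ 2)) := by gcongr
    _ = Real.exp (p * x ^ 2) := by rw [← Real.exp_add]; ring_nf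

lemma lintegral_prod_expWeight_le_of_indepSet (G : DepRandomGraph n p d) (hp0 : 0 ≤ p) {x : ℝ}
    (hx : |x| ≤ 1) (C : Finset (EdgeIdx n)) (hC : ∀ e ∈ C, ∀ f ∈ C, ¬ G.D.Adj e f) :
    ∫⁻ ω, ∏ e ∈ C, G.expWeight x e ω ∂G.μ ≤ ENNReal.ofReal (Real.exp (p * x ^ 2)) ^ C.card := by
  classical
  induction C using Finset.induction_on with
  | empty => simp
  | insert a C ha ih =>
    have hmeas : Measurable[⨆ f ∈ {f : EdgeIdx n | f ≠ a ∧ ¬ G.D.Adj a f},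
        MeasurableSpace.comap (G.X f) ⊤] (fun ω => ∏ e ∈ C, G.expWeight x e ω) := by
      refine Finset.measurable_fun_prod C fun f hf => ?_
      refine (G.measurable_expWeight_comap x f).mono ?_ le_rfl
      exact le_iSup₂_of_le f ⟨fun h => ha (h ▸ hf),
        hC a (Finset.mem_insert_self _ _) f (Finset.mem_insert_of_mem hf)⟩ le_rfl
    simp_rw [Finset.prod_insert ha]
    rw [lintegral_mul_eq_lintegral_mul_lintegral_of_independent_measurableSpace
      (G.meas a).comap_le (iSup₂_le fun f _ => (G.meas f).comap_le) (G.indep a)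
      (G.measurable_expWeight_comap x a) hmeas, Finset.card_insert_of_notMem ha, pow_succ']
    exact mul_le_mul' (G.lintegral_expWeight_le hp0 hx a) (ih fun e he f hf =>
      hC e (Finset.mem_insert_of_mem he) f (Finset.mem_insert_of_mem hf))

lemma lintegral_prod_expWeight_le (G : DepRandomGraph n p d) (hp0 : 0 ≤ p) {x : ℝ}
    (hx : |x| ≤ 1) (T : Finset (EdgeIdx n)) :
    ∫⁻ ω, ∏ e ∈ T, G.expWeight (x / (d + 1)) e ω ∂G.μ ≤
      ENNReal.ofReal (Real.exp (T.card * p * x ^ 2 / (d + 1))) := by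
  classical
  obtain ⟨c, hc⟩ := G.D.exists_coloring_on_of_ncard_le d G.degBound T
  have hk : (0 : ℝ) < d + 1 := by positivity
  have hroot : ∀ e ω, G.expWeight (x / (d + 1)) e ω = G.expWeight x e ω ^ (1 / ((d : ℝ) + 1)) := by
    intro e ω
    rw [expWeight, expWeight, ENNReal.ofReal_rpow_of_pos (Real.exp_pos _), ← Real.exp_mul]
    congr 2
    ring
  calc ∫⁻ ω, ∏ e ∈ T, G.expWeight (x / (d + 1)) e ω ∂G.μ
      = ∫⁻ ω, ∏ j : Fin (d + 1),
          (∏ e ∈ T with c e = j, G.expWeight x e ω) ^ (1 / ((d : ℝ) + 1)) ∂G.μ := by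
        refine lintegral_congr fun ω => ?_
        rw [← Finset.prod_fiberwise T c]
        refine Finset.prod_congr rfl fun j _ => ?_
        rw [← ENNReal.prod_rpow_of_nonneg (by positivity)]
        exact Finset.prod_congr rfl fun e _ => hroot e ω
    _ ≤ ∏ j : Fin (d + 1),
          (∫⁻ ω, ∏ e ∈ T with c e = j, G.expWeight x e ω ∂G.μ) ^ (1 / ((d : ℝ) + 1)) := by
        refine ENNReal.lintegral_prod_norm_pow_le _ (fun j _ => ?_) ?_ fun _ _ => by positivity
        · exact (Finset.measurable_fun_prod _ fun e _ => G.measurable_expWeight x e).aemeasurable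
        · simp; field_simp
    _ ≤ ∏ j : Fin (d + 1), (ENNReal.ofReal (Real.exp (p * x ^ 2)) ^
          (T.filter fun e => c e = j).card) ^ (1 / ((d : ℝ) + 1)) := by
        gcongr with j
        refine G.lintegral_prod_expWeight_le_of_indepSet hp0 hx _ fun e he f hf h => ?_
        rw [Finset.mem_filter] at he hf
        exact hc e he.1 f hf.1 h (he.2.trans hf.2.symm)
    _ = ENNReal.ofReal (Real.exp (T.card * p * x ^ 2 / (d + 1))) := by
        rw [ENNReal.prod_rpow_of_nonneg (by positivity), Finset.prod_pow_eq_pow_sum,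
          ← Finset.card_eq_sum_card_fiberwise (fun _ _ => Finset.mem_univ _),
          ← ENNReal.ofReal_pow (Real.exp_pos _).le,
          ENNReal.ofReal_rpow_of_pos (by positivity), ← Real.exp_nat_mul, ← Real.exp_mul]
        congr 2
        ring

lemma measure_le_mul_sum_ind_sub_le (G : DepRandomGraph n p d) (hp0 : 0 ≤ p) {x : ℝ}
    (hx : |x| ≤ 1) (T : Finset (EdgeIdx n)) (a : ℝ) :
    G.μ {ω | a ≤ x * (∑ e ∈ T, G.ind e ω - T.card * p)} ≤
      ENNReal.ofReal (Real.exp ((T.card * p * x ^ 2 - a) / (d + 1))) := by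
  have hk : (0 : ℝ) < d + 1 := by positivity
  have hpos : 0 < Real.exp (a / (d + 1)) := Real.exp_pos _
  have hsub : {ω | a ≤ x * (∑ e ∈ T, G.ind e ω - T.card * p)} ⊆
      {ω | ENNReal.ofReal (Real.exp (a / (d + 1))) ≤
        ∏ e ∈ T, G.expWeight (x / (d + 1)) e ω} := by
    intro ω hω
    rw [Set.mem_ofPred_eq] at hω ⊢
    rw [prod_expWeight, div_mul_eq_mul_div]
    gcongr
  refine (measure_mono hsub).trans ((meas_ge_le_lintegral_div ?_ ?_ ENNReal.ofReal_ne_top).trans ?_)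
  · exact (Finset.measurable_fun_prod _ fun e _ => G.measurable_expWeight _ e).aemeasurable
  · exact (ENNReal.ofReal_pos.2 hpos).ne'
  · rw [sub_div, Real.exp_sub, ENNReal.ofReal_div_of_pos hpos]
    exact ENNReal.div_le_div_right (G.lintegral_prod_expWeight_le hp0 hx T) _

/-- The edges at a vertex `v`, indexed by their other endpoint. -/
def starEdge (v : Fin n) : {u : Fin n // u ≠ v} ↪ EdgeIdx n where
  toFun u := ⟨s(v, u.1), fun h => u.2 (Sym2.mk_isDiag_iff.1 h).symm⟩
  inj' _ _ h := Subtype.ext (Sym2.congr_right.1 (congrArg Subtype.val h))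

/-- The set of potential edges at a vertex. -/
def star (v : Fin n) : Finset (EdgeIdx n) := Finset.univ.map (starEdge v)

lemma card_star (v : Fin n) : (star v).card = n - 1 := by
  simp [star, Fintype.card_subtype_compl]

lemma deg_eq_sum_ind (G : DepRandomGraph n p d) (ω : G.Ω) (v : Fin n) :
    (G.deg ω v : ℝ) = ∑ e ∈ star v, G.ind e ω := by
  have himg : {u | (G.graph ω).Adj v u} = Subtype.val ''
      (↑(Finset.univ.filter fun u : {u : Fin n // u ≠ v} => G.X (starEdge v u) ω = true) :
        Set {u : Fin n // u ≠ v}) := by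
    ext u
    simp only [graph, SimpleGraph.fromEdgeSet_adj, Set.mem_ofPred_eq, Set.mem_image,
      Finset.coe_filter, Finset.mem_univ, true_and]
    constructor
    · rintro ⟨⟨_, hX⟩, hne⟩
      exact ⟨⟨u, hne.symm⟩, hX, rfl⟩
    · rintro ⟨w, hw, rfl⟩
      exact ⟨⟨_, hw⟩, w.2.symm⟩
  rw [deg, himg, Set.ncard_image_of_injective _ Subtype.val_injective, Set.ncard_coe_finset,
    star, Finset.sum_map]
  simp [ind]

lemma measure_deg_notMem_le (G : DepRandomGraph n p d) (hn : 3 ≤ n)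
    (hp : p ≥ ((d : ℝ) + 1) * Real.log n / n) (v : Fin n) :
    G.μ {ω | ¬ ((n : ℝ) * p - 4 * Real.sqrt ((n : ℝ) * p * ((d : ℝ) + 1) * Real.log n)
              ≤ (G.deg ω v : ℝ) ∧
          (G.deg ω v : ℝ)
              ≤ (n : ℝ) * p + 4 * Real.sqrt ((n : ℝ) * p * ((d : ℝ) + 1) * Real.log n))} ≤
      ENNReal.ofReal (2 / (n : ℝ) ^ 2) := by
  have hn0 : (0 : ℝ) < n := by positivity
  have hL : 1 ≤ Real.log n := by
    rw [Real.le_log_iff_exp_le hn0]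
    have : (3 : ℝ) ≤ n := by exact_mod_cast hn
    linarith [Real.exp_one_lt_three]
  have hk : (1 : ℝ) ≤ d + 1 := by simp
  set L := Real.log n with hLdef
  set k : ℝ := (d : ℝ) + 1 with hkdef
  have hkL : k * L ≤ n * p := by
    rw [ge_iff_le, div_le_iff₀ hn0] at hp
    linarith
  have hkL1 : 1 ≤ k * L := one_le_mul_of_one_le_of_one_le hk hL
  have hnp : 0 < n * p := by linarith
  have hp_pos : 0 < p := pos_of_mul_pos_right hnp hn0.le
  have hp0 : 0 ≤ p := hp_pos.le
  have hp1 : p ≤ 1 := by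
    obtain ⟨u, hu⟩ : ∃ u : Fin n, u ≠ v := by
      have : Nontrivial (Fin n) := Fin.nontrivial_iff_two_le.2 (by omega)
      exact exists_ne v
    exact G.prob_edge_le_one (starEdge v ⟨u, hu⟩)
  set s := Real.sqrt (n * p * k * L) with hs
  have hs2 : s ^ 2 = n * p * (k * L) := by
    rw [hs, Real.sq_sqrt (by positivity)]; ring
  have hs0 : 0 ≤ s := Real.sqrt_nonneg _
  have hs1 : 1 ≤ s := by nlinarith
  have hsnp : s ≤ n * p := by nlinarith
  have hcard : ((star v).card : ℝ) = n - 1 := by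
    rw [card_star, Nat.cast_sub (by omega), Nat.cast_one]
  have hbound : ∀ x : ℝ, |x| = s / (n * p) →
      G.μ {ω | 3 * (k * L) ≤ x * (∑ e ∈ star v, G.ind e ω - (star v).card * p)} ≤
        ENNReal.ofReal (1 / (n : ℝ) ^ 2) := by
    intro x hx
    refine (G.measure_le_mul_sum_ind_sub_le hp0 (hx ▸ (div_le_one hnp).2 hsnp) _ _).trans
      (ENNReal.ofReal_le_ofReal ?_)
    have hx2 : n * p * x ^ 2 = k * L := by
      rw [← sq_abs, hx, div_pow, hs2]; field_simp
    have hexp : Real.exp (-(2 * L)) = 1 / (n : ℝ) ^ 2 := by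
      rw [Real.exp_neg, two_mul, Real.exp_add, hLdef, Real.exp_log hn0]; field_simp
    rw [← hexp, hcard, Real.exp_le_exp, ← hkdef, div_le_iff₀ (by linarith)]
    nlinarith [mul_nonneg hp0 (sq_nonneg x)]
  have hsx : 3 * (k * L) = s / (n * p) * (3 * s) := by
    have : s / (n * p) * (3 * s) = 3 * s ^ 2 / (n * p) := by ring
    rw [this, hs2]; field_simp
  have hx0 : 0 ≤ s / (n * p) := by positivity
  calc _ ≤ G.μ ({ω | 3 * (k * L) ≤
              s / (n * p) * (∑ e ∈ star v, G.ind e ω - (star v).card * p)} ∪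
            {ω | 3 * (k * L) ≤
              -(s / (n * p)) * (∑ e ∈ star v, G.ind e ω - (star v).card * p)}) := by
        refine measure_mono fun ω hω => ?_
        simp only [Set.mem_ofPred_eq, not_and_or, not_le, deg_eq_sum_ind] at hω
        simp only [Set.mem_union, Set.mem_ofPred_eq, hsx, hcard]
        rcases hω with h | h
        · right
          rw [neg_mul, ← mul_neg]
          exact mul_le_mul_of_nonneg_left (by linarith) hx0
        · left
          exact mul_le_mul_of_nonneg_left (by linarith) hx0
    _ ≤ ENNReal.ofReal (1 / (n : ℝ) ^ 2) + ENNReal.ofReal (1 / (n : ℝ) ^ 2) :=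
        (measure_union_le _ _).trans (add_le_add (hbound _ (abs_of_nonneg hx0))
          (hbound _ (by rw [abs_neg, abs_of_nonneg hx0])))
    _ = ENNReal.ofReal (2 / (n : ℝ) ^ 2) := by
        rw [← ENNReal.ofReal_add (by positivity) (by positivity)]; ring_nf

end DepRandomGraph

/-- **Degree concentration.** If `p(n) ≥ (d(n)+1) ln(n)/n`, then for any sequence of
`d(n)`-dependent random graph distributions, almost surely every vertex has degree
within `4√(np(d+1)ln n)` of `np`. -/
theorem degree_concentration (p : ℕ → ℝ) (d : ℕ → ℕ)
    (hp : ∀ n : ℕ, p n ≥ ((d n : ℝ) + 1) * Real.log n / n)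
    (G : (n : ℕ) → DepRandomGraph n (p n) (d n)) :
    Tendsto
      (fun n : ℕ => (G n).μ {ω | ∀ v : Fin n,
          (n : ℝ) * p n - 4 * Real.sqrt ((n : ℝ) * p n * ((d n : ℝ) + 1) * Real.log n)
              ≤ ((G n).deg ω v : ℝ) ∧
          ((G n).deg ω v : ℝ)
              ≤ (n : ℝ) * p n + 4 * Real.sqrt ((n : ℝ) * p n * ((d n : ℝ) + 1) * Real.log n)})
      atTop (nhds 1) := by
  have hlim : Tendsto (fun n : ℕ => 1 - ENNReal.ofReal (2 / (n : ℝ))) atTop (nhds 1) := by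
    have h := ENNReal.tendsto_ofReal (tendsto_const_div_atTop_nhds_zero_nat (2 : ℝ))
    rw [ENNReal.ofReal_zero] at h
    simpa using ENNReal.Tendsto.sub tendsto_const_nhds h (Or.inl ENNReal.one_ne_top)
  refine tendsto_of_tendsto_of_tendsto_of_le_of_le' hlim tendsto_const_nhds ?_
    (Eventually.of_forall fun n => prob_le_one)
  filter_upwards [eventually_ge_atTop 3] with n hn
  rw [tsub_le_iff_right, ← measure_univ (μ := (G n).μ)]
  refine (measure_univ_le_add_compl _).trans (add_le_add_right ?_ _)
  have hn0 : (0 : ℝ) < n := by positivity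
  rw [Set.compl_ofPred]
  simp only [not_forall]
  rw [Set.ofPred_exists]
  refine (measure_iUnion_fintype_le _ _).trans
    ((Finset.sum_le_sum fun v _ => (G n).measure_deg_notMem_le hn (hp n) v).trans ?_)
  rw [Finset.sum_const, Finset.card_univ, Fintype.card_fin, nsmul_eq_mul,
    ← ENNReal.ofReal_natCast, ← ENNReal.ofReal_mul hn0.le]
  apply ENNReal.ofReal_le_ofReal
  apply le_of_eq
  field_simp
end

section
/- Fix a constant C ≥ 10. Let p = p(n) and d = d(n) be sequences, and for each n let G ~ G_{n,p(n),d(n)} be a d(n)-dependent random graph distribution on n vertices such that the probability that the maximum degree of G is at most (C²/14)·n·p tends to 1 as n → ∞. Then the probability that every pair of vertex subsets A, B simultaneously satisfies |e(A,B) − p·|A|·|B|| ≤ C·√(|A|·|B|·n·p·(d+1)) tends to 1 as n → ∞. -/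
open MeasureTheory ProbabilityTheory Filter

/-- Greedy colouring: a graph of maximum degree at most `d` is `(d + 1)`-colourable. -/
theorem SimpleGraph.exists_coloring_of_ncard_neighborSet_le {V : Type*} [Finite V]
    (D : SimpleGraph V) {d : ℕ} (h : ∀ v, (D.neighborSet v).ncard ≤ d) :
    ∃ c : V → Fin (d + 1), ∀ u v, D.Adj u v → c u ≠ c v := by
  classical
  have := Fintype.ofFinite V
  suffices H : ∀ s : Finset V, ∃ c : V → Fin (d + 1),
      ∀ u ∈ s, ∀ v ∈ s, D.Adj u v → c u ≠ c v by
    obtain ⟨c, hc⟩ := H Finset.univ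
    exact ⟨c, fun u v => hc u (Finset.mem_univ _) v (Finset.mem_univ _)⟩
  intro s
  induction s using Finset.induction_on with
  | empty => exact ⟨fun _ => 0, by simp⟩
  | insert a s ha ih =>
    obtain ⟨c, hc⟩ := ih
    obtain ⟨j, hj⟩ : ∃ j, j ∉ c '' D.neighborSet a := by
      by_contra! hall
      have h1 : (c '' D.neighborSet a) = Set.univ := Set.eq_univ_of_forall hall
      have h2 := (Set.ncard_image_le (f := c) (D.neighborSet a).toFinite).trans (h a)
      rw [h1, Set.ncard_univ, Nat.card_fin] at h2
      omega
    refine ⟨Function.update c a j, fun u hu v hv huv => ?_⟩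
    rcases eq_or_ne u a with rfl | hua <;> rcases eq_or_ne v u with rfl | hvu
    · exact absurd huv D.irrefl
    · rw [Function.update_self, Function.update_of_ne hvu]
      exact fun hjv => hj ⟨v, huv, hjv.symm⟩
    · exact absurd huv D.irrefl
    · rw [Function.update_of_ne hua]
      rcases eq_or_ne v a with rfl | hva
      · rw [Function.update_self]
        exact fun hju => hj ⟨u, huv.symm, hju⟩
      · rw [Function.update_of_ne hva]
        exact hc u (Finset.mem_of_mem_insert_of_ne hu hua) v
          (Finset.mem_of_mem_insert_of_ne hv hva) huv

theorem exp_neg_le_quadratic {x : ℝ} (hx : 0 ≤ x) : Real.exp (-x) ≤ 1 - x + x ^ 2 / 2 := by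
  rw [Real.exp_neg, inv_le_iff_one_le_mul₀ (Real.exp_pos x)]
  have h := Real.quadratic_le_exp_of_nonneg hx
  have h2 : 0 < 1 - x + x ^ 2 / 2 := by nlinarith [sq_nonneg (x - 1)]
  nlinarith [mul_le_mul_of_nonneg_left h h2.le, sq_nonneg (x ^ 2)]

namespace DepRandomGraph

variable {n : ℕ} {p : ℝ} {d : ℕ}

theorem measurable_X (G : DepRandomGraph n p d) (e : EdgeIdx n) : Measurable (G.X e) := by
  have := G.meas e
  intro s _
  exact this trivial

theorem comap_X_le (G : DepRandomGraph n p d) (e : EdgeIdx n) :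
    MeasurableSpace.comap (G.X e) ⊤ ≤ G.m :=
  (G.meas e).comap_le

theorem lintegral_exp_edge_le (G : DepRandomGraph n p d) (hp : 0 ≤ p) (e : EdgeIdx n) (a : ℝ) :
    ∫⁻ ω, ENNReal.ofReal (Real.exp (if G.X e ω then a else 0)) ∂G.μ ≤
      ENNReal.ofReal (Real.exp (p * (Real.exp a - 1))) := by
  have hS : MeasurableSet {ω | G.X e ω = true} := G.measurable_X e (measurableSet_singleton true)
  have hp1 : p ≤ 1 := by
    have h := prob_le_one (μ := G.μ) (s := {ω | G.X e ω = true})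
    rwa [G.probX, ENNReal.ofReal_le_one] at h
  have hfun : (fun ω => ENNReal.ofReal (Real.exp (if G.X e ω then a else 0))) =
      fun ω => {ω | G.X e ω = true}.indicator (fun _ => ENNReal.ofReal (Real.exp a)) ω +
        {ω | G.X e ω = true}ᶜ.indicator (fun _ => 1) ω := by
    funext ω
    by_cases h : G.X e ω = true <;> simp [h]
  rw [hfun, lintegral_add_left (measurable_const.indicator hS), lintegral_indicator_const hS,
    lintegral_indicator_const hS.compl, prob_compl_eq_one_sub hS, G.probX, one_mul,
    ← ENNReal.ofReal_one, ← ENNReal.ofReal_sub _ hp, ← ENNReal.ofReal_mul (Real.exp_nonneg _),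
    ← ENNReal.ofReal_add (by positivity) (by linarith)]
  apply ENNReal.ofReal_le_ofReal
  linarith [Real.add_one_le_exp (p * (Real.exp a - 1))]

theorem lintegral_prod_eq_prod_lintegral (G : DepRandomGraph n p d) (g : EdgeIdx n → Bool → ENNReal)
    (s : Finset (EdgeIdx n)) (hs : ∀ e ∈ s, ∀ f ∈ s, ¬ G.D.Adj e f) :
    ∫⁻ ω, ∏ e ∈ s, g e (G.X e ω) ∂G.μ = ∏ e ∈ s, ∫⁻ ω, g e (G.X e ω) ∂G.μ := by
  induction s using Finset.induction_on with
  | empty => simp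
  | insert a s ha ih =>
    simp only [Finset.prod_insert ha]
    rw [← ih fun e he f hf => hs e (Finset.mem_insert_of_mem he) f (Finset.mem_insert_of_mem hf)]
    refine lintegral_mul_eq_lintegral_mul_lintegral_of_independent_measurableSpace
      (G.comap_X_le a) (iSup₂_le fun f _ => G.comap_X_le f) (G.indep a) ?_ ?_
    · exact measurable_from_top.comp (comap_measurable (G.X a))
    · refine Finset.measurable_prod _ fun f hf => ?_
      have hle : MeasurableSpace.comap (G.X f) ⊤ ≤
          ⨆ f ∈ {f : EdgeIdx n | f ≠ a ∧ ¬ G.D.Adj a f}, MeasurableSpace.comap (G.X f) ⊤ :=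
        le_iSup₂_of_le f ⟨fun h => ha (h ▸ hf), hs a (Finset.mem_insert_self _ _) f
          (Finset.mem_insert_of_mem hf)⟩ le_rfl
      exact (measurable_from_top.comp (comap_measurable (G.X f))).mono hle le_rfl

/-- The moment generating function of a weighted sum of the edge indicators: split the edges into
`d + 1` classes of independent edges and apply Hölder's inequality. -/
theorem lintegral_exp_sum_le (G : DepRandomGraph n p d) (hp : 0 ≤ p) (a : EdgeIdx n → ℝ) :
    ∫⁻ ω, ENNReal.ofReal (Real.exp (∑ e, if G.X e ω then a e else 0)) ∂G.μ ≤
      ENNReal.ofReal (Real.exp (p / (d + 1) * ∑ e, (Real.exp ((d + 1) * a e) - 1))) := by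
  obtain ⟨c, hc⟩ := G.D.exists_coloring_of_ncard_neighborSet_le G.degBound
  have hd : (0 : ℝ) < d + 1 := by positivity
  set g : EdgeIdx n → Bool → ENNReal :=
    fun e x => ENNReal.ofReal (Real.exp (if x then (d + 1) * a e else 0)) with hg
  set f : Fin (d + 1) → G.Ω → ENNReal :=
    fun j ω => ∏ e with c e = j, g e (G.X e ω) with hf
  have hfm (j) : Measurable (f j) :=
    Finset.measurable_prod _ fun e _ => (measurable_from_top (f := g e)).comp (G.measurable_X e)
  have hpow (x : ℝ) : ENNReal.ofReal (Real.exp x) ^ (1 / ((d : ℝ) + 1)) =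
      ENNReal.ofReal (Real.exp (x / (d + 1))) := by
    rw [ENNReal.ofReal_rpow_of_pos (Real.exp_pos _), ← Real.exp_mul, mul_one_div]
  have hfprod (j ω) : f j ω =
      ENNReal.ofReal (Real.exp (∑ e with c e = j, if G.X e ω then (d + 1) * a e else 0)) := by
    rw [Real.exp_sum, ENNReal.ofReal_prod_of_nonneg fun _ _ => (Real.exp_pos _).le]
  have hint (j) : ∫⁻ ω, f j ω ∂G.μ ≤
      ENNReal.ofReal (Real.exp (∑ e with c e = j, p * (Real.exp ((d + 1) * a e) - 1))) := by
    rw [Real.exp_sum, ENNReal.ofReal_prod_of_nonneg fun _ _ => (Real.exp_pos _).le,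
      G.lintegral_prod_eq_prod_lintegral g]
    · exact Finset.prod_le_prod' fun e _ => G.lintegral_exp_edge_le hp e _
    · intro e he f hf hef
      exact hc e f hef (by simp_all)
  calc ∫⁻ ω, ENNReal.ofReal (Real.exp (∑ e, if G.X e ω then a e else 0)) ∂G.μ
      = ∫⁻ ω, ∏ j, f j ω ^ (1 / ((d : ℝ) + 1)) ∂G.μ := by
        refine lintegral_congr fun ω => ?_
        simp only [hfprod, hpow]
        rw [← ENNReal.ofReal_prod_of_nonneg fun _ _ => (Real.exp_pos _).le, ← Real.exp_sum,
          ← Finset.sum_div, Finset.sum_fiberwise, Finset.sum_div]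
        congr 3
        funext e
        split_ifs
        · field_simp
        · simp
    _ ≤ ∏ j, (∫⁻ ω, f j ω ∂G.μ) ^ (1 / ((d : ℝ) + 1)) :=
        ENNReal.lintegral_prod_norm_pow_le _ (fun j _ => (hfm j).aemeasurable)
          (by simp; field_simp) fun _ _ => by positivity
    _ ≤ ∏ j, ENNReal.ofReal (Real.exp (∑ e with c e = j,
          p * (Real.exp ((d + 1) * a e) - 1))) ^ (1 / ((d : ℝ) + 1)) :=
        Finset.prod_le_prod' fun j _ => ENNReal.rpow_le_rpow (hint j) (by positivity)
    _ = _ := by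
        simp only [hpow]
        rw [← ENNReal.ofReal_prod_of_nonneg fun _ _ => (Real.exp_pos _).le, ← Real.exp_sum,
          ← Finset.sum_div, Finset.sum_fiberwise, ← Finset.mul_sum, mul_div_right_comm]

/-- The Chernoff bound for a weighted sum of the edge indicators. -/
theorem measure_le_sum_le (G : DepRandomGraph n p d) (hp : 0 ≤ p) (a : EdgeIdx n → ℝ) (y : ℝ) :
    G.μ {ω | y ≤ ∑ e, if G.X e ω then a e else 0} ≤
      ENNReal.ofReal (Real.exp (p / (d + 1) * ∑ e, (Real.exp ((d + 1) * a e) - 1) - y)) := by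
  have hm : Measurable fun ω =>
      ENNReal.ofReal (Real.exp (∑ e, if G.X e ω then a e else 0)) := by
    refine ENNReal.measurable_ofReal.comp (Real.measurable_exp.comp ?_)
    exact Finset.measurable_sum _ fun e _ =>
      (measurable_from_top (f := fun x : Bool => if x then a e else 0)).comp (G.measurable_X e)
  have h := (mul_meas_ge_le_lintegral (μ := G.μ) hm (ENNReal.ofReal (Real.exp y))).trans
    (G.lintegral_exp_sum_le hp a)
  have hset : {ω | ENNReal.ofReal (Real.exp y) ≤
      ENNReal.ofReal (Real.exp (∑ e, if G.X e ω then a e else 0))} =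
      {ω | y ≤ ∑ e, if G.X e ω then a e else 0} := by
    ext ω
    simp only [Set.mem_ofPred_eq]
    rw [ENNReal.ofReal_le_ofReal_iff (Real.exp_pos _).le, Real.exp_le_exp]
  rw [hset] at h
  rw [Real.exp_sub, ENNReal.ofReal_div_of_pos (Real.exp_pos _),
    ENNReal.le_div_iff_mul_le (by simp [Real.exp_pos]) (by simp), mul_comm]
  exact h

/-- The number of ordered pairs in `A ×ˢ B` whose endpoints form the edge `e`. -/
def edgeWeight (A B : Finset (Fin n)) (e : EdgeIdx n) : ℕ :=
  ((A ×ˢ B).filter fun q => s(q.1, q.2) = e.1).card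

theorem edgeWeight_le_two (A B : Finset (Fin n)) (e : EdgeIdx n) : edgeWeight A B e ≤ 2 := by
  obtain ⟨⟨x, y⟩, he⟩ := e
  refine (Finset.card_le_card (t := {(x, y), (y, x)}) fun q hq => ?_).trans Finset.card_le_two
  have h := (Finset.mem_filter.1 hq).2
  rcases Sym2.eq_iff.1 h with ⟨h1, h2⟩ | ⟨h1, h2⟩
  · simp [← h1, ← h2]
  · simp [← h1, ← h2]

theorem sum_edgeWeight_mul (A B : Finset (Fin n)) (x : EdgeIdx n → ℝ) :
    ∑ e, (edgeWeight A B e : ℝ) * x e =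
      ∑ q ∈ A ×ˢ B, if h : q.1 ≠ q.2 then x ⟨s(q.1, q.2), by simpa using h⟩ else 0 := by
  simp only [edgeWeight, Finset.card_filter, Nat.cast_sum, Finset.sum_mul]
  rw [Finset.sum_comm]
  refine Finset.sum_congr rfl fun q _ => ?_
  split_ifs with h
  · rw [Finset.sum_eq_single ⟨s(q.1, q.2), by simpa using h⟩]
    · simp
    · intro e _ he
      rw [if_neg fun h' => he (Subtype.ext h'.symm)]
      simp
    · simp
  · refine Finset.sum_eq_zero fun e _ => ?_
    rw [if_neg fun h' : s(q.1, q.2) = e.1 => e.2 (by rw [← h']; simpa using h)]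
    simp

theorem adj_graph_iff (G : DepRandomGraph n p d) (ω : G.Ω) (u v : Fin n) :
    (G.graph ω).Adj u v ↔ ∃ h : u ≠ v, G.X ⟨s(u, v), by simpa using h⟩ ω = true := by
  rw [graph, SimpleGraph.fromEdgeSet_adj]
  constructor
  · rintro ⟨⟨h, hX⟩, huv⟩
    exact ⟨huv, hX⟩
  · rintro ⟨huv, hX⟩
    exact ⟨⟨by simpa using huv, hX⟩, huv⟩

theorem eAB_eq_card (G : DepRandomGraph n p d) (ω : G.Ω) (A B : Finset (Fin n))
    [DecidableRel (G.graph ω).Adj] :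
    G.eAB ω A B = ((A ×ˢ B).filter fun q => (G.graph ω).Adj q.1 q.2).card := by
  rw [eAB, ← Set.ncard_coe_finset]
  congr 1
  ext q
  simp [and_assoc]

theorem eAB_eq_sum (G : DepRandomGraph n p d) (ω : G.Ω) (A B : Finset (Fin n)) :
    (G.eAB ω A B : ℝ) = ∑ e, if G.X e ω then (edgeWeight A B e : ℝ) else 0 := by
  classical
  have h := sum_edgeWeight_mul A B fun e => if G.X e ω then 1 else 0
  simp only [mul_ite, mul_one, mul_zero] at h
  rw [h, eAB_eq_card, Finset.card_filter, Nat.cast_sum]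
  refine Finset.sum_congr rfl fun q _ => ?_
  simp only [adj_graph_iff]
  by_cases h1 : q.1 = q.2
  · simp [h1]
  · simp [h1]

theorem sum_edgeWeight (A B : Finset (Fin n)) :
    ∑ e, (edgeWeight A B e : ℝ) = A.card * B.card - (A ∩ B).card := by
  have h := sum_edgeWeight_mul A B fun _ => 1
  simp only [mul_one, dite_eq_ite, ne_eq, ite_not] at h
  have h2 : ((A ×ˢ B).filter fun q => q.1 = q.2).card = (A ∩ B).card := by
    rw [← Finset.card_map (s := A ∩ B) ⟨fun x => (x, x), fun x y h => congrArg Prod.fst h⟩]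
    congr 1
    ext ⟨x, y⟩
    simp only [Finset.mem_filter, Finset.mem_product, Finset.mem_map, Finset.mem_inter]
    constructor
    · rintro ⟨⟨hx, hy⟩, rfl⟩
      exact ⟨x, ⟨hx, hy⟩, rfl⟩
    · rintro ⟨z, ⟨hx, hy⟩, hz⟩
      obtain ⟨rfl, rfl⟩ := Prod.mk.inj hz
      exact ⟨⟨hx, hy⟩, rfl⟩
  have h3 : ∑ q ∈ A ×ˢ B, (if q.1 = q.2 then (0 : ℝ) else 1) +
      ∑ q ∈ A ×ˢ B, (if q.1 = q.2 then (1 : ℝ) else 0) = A.card * B.card := by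
    rw [← Finset.sum_add_distrib, ← Nat.cast_mul, ← Finset.card_product, Finset.card_eq_sum_ones,
      Nat.cast_sum]
    refine Finset.sum_congr rfl fun q _ => ?_
    split_ifs <;> simp
  rw [← Finset.natCast_card_filter, h2] at h3
  rw [h]
  linarith

theorem eAB_comm (G : DepRandomGraph n p d) (ω : G.Ω) (A B : Finset (Fin n)) :
    G.eAB ω A B = G.eAB ω B A := by
  rw [eAB, eAB, ← Set.ncard_image_of_injective _ Prod.swap_injective]
  congr 1
  ext ⟨x, y⟩
  simp only [Set.mem_image, Set.mem_ofPred_eq, Prod.exists, Prod.swap_prod_mk, Prod.mk.injEq]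
  constructor
  · rintro ⟨u, v, ⟨h1, h2, h3⟩, rfl, rfl⟩
    exact ⟨h2, h1, h3.symm⟩
  · rintro ⟨h1, h2, h3⟩
    exact ⟨y, x, ⟨h2, h1, h3.symm⟩, rfl, rfl⟩

theorem eAB_le_card_mul (G : DepRandomGraph n p d) (ω : G.Ω) (A B : Finset (Fin n)) {Δ : ℝ}
    (hΔ : ∀ v, (G.deg ω v : ℝ) ≤ Δ) : (G.eAB ω A B : ℝ) ≤ A.card * Δ := by
  classical
  rw [eAB_eq_card, Finset.card_filter, Finset.sum_product, Nat.cast_sum, ← nsmul_eq_mul]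
  refine Finset.sum_le_card_nsmul _ _ _ fun v _ => (Nat.cast_le.2 ?_).trans (hΔ v)
  rw [← Finset.card_filter, deg, ← Set.ncard_coe_finset]
  refine Set.ncard_le_ncard (fun u hu => ?_) (Set.toFinite _)
  simp at hu
  exact hu.2

theorem measure_le_eAB_le (G : DepRandomGraph n p d) (hp : 0 ≤ p) (A B : Finset (Fin n))
    (y : ℝ) {s : ℝ} (hs : 0 ≤ s) :
    G.μ {ω | y ≤ (G.eAB ω A B : ℝ)} ≤ ENNReal.ofReal (Real.exp
      ((p * A.card * B.card * (Real.exp s - 1) - s * y) / (2 * (d + 1)))) := by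
  have hd : (0 : ℝ) < d + 1 := by positivity
  rcases hs.eq_or_lt with rfl | hs
  · simpa using prob_le_one
  set l : ℝ := s / (2 * (d + 1)) with hl
  have hl0 : 0 < l := by positivity
  have hset : {ω | y ≤ (G.eAB ω A B : ℝ)} =
      {ω | l * y ≤ ∑ e, if G.X e ω then l * edgeWeight A B e else 0} := by
    ext ω
    simp only [Set.mem_ofPred_eq]
    rw [eAB_eq_sum, ← mul_le_mul_iff_right₀ hl0, Finset.mul_sum]
    simp only [mul_ite, mul_zero]
  rw [hset]
  refine (G.measure_le_sum_le hp _ _).trans (ENNReal.ofReal_le_ofReal (Real.exp_le_exp.2 ?_))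
  have hsum : ∑ e, (Real.exp ((d + 1) * (l * edgeWeight A B e)) - 1) ≤
      (A.card * B.card) * ((Real.exp s - 1) / 2) := by
    have hW : ∑ e, (edgeWeight A B e : ℝ) ≤ A.card * B.card := by
      rw [sum_edgeWeight]
      linarith [Nat.cast_nonneg (α := ℝ) (A ∩ B).card]
    have h1 := Real.one_le_exp hs.le
    refine le_trans ?_ (mul_le_mul_of_nonneg_right hW (by linarith))
    rw [Finset.sum_mul]
    refine Finset.sum_le_sum fun e _ => ?_
    have h2 := edgeWeight_le_two A B e
    have h3 : (d + 1) * (l * edgeWeight A B e) = s / 2 * edgeWeight A B e := by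
      rw [hl]; field_simp
    have h4 : Real.exp s = Real.exp (s / 2) ^ 2 := by
      rw [← Real.exp_nat_mul]; congr 1; push_cast; ring
    rw [h3]
    interval_cases edgeWeight A B e
    · simp
    · simp only [Nat.cast_one, mul_one, h4]
      nlinarith [sq_nonneg (Real.exp (s / 2) - 1)]
    · simp only [Nat.cast_ofNat, div_mul_cancel₀ s (two_ne_zero' ℝ)]
      linarith
  calc p / (d + 1) * ∑ e, (Real.exp ((d + 1) * (l * edgeWeight A B e)) - 1) - l * y
      ≤ p / (d + 1) * ((A.card * B.card) * ((Real.exp s - 1) / 2)) - l * y := by gcongr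
    _ = _ := by rw [hl]; field_simp

theorem measure_eAB_le_le (G : DepRandomGraph n p d) (hp : 0 ≤ p) (A B : Finset (Fin n))
    (y : ℝ) {s : ℝ} (hs : 0 ≤ s) :
    G.μ {ω | (G.eAB ω A B : ℝ) ≤ y} ≤ ENNReal.ofReal (Real.exp
      ((p * A.card * B.card * s ^ 2 - s * (p * A.card * B.card - p * (A ∩ B).card - y)) /
        (d + 1))) := by
  have hd : (0 : ℝ) < d + 1 := by positivity
  rcases hs.eq_or_lt with rfl | hs
  · simpa using prob_le_one
  set l : ℝ := s / (d + 1) with hl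
  have hl0 : 0 < l := by positivity
  have hset : {ω | (G.eAB ω A B : ℝ) ≤ y} =
      {ω | -(l * y) ≤ ∑ e, if G.X e ω then -(l * edgeWeight A B e) else 0} := by
    ext ω
    simp only [Set.mem_ofPred_eq]
    rw [eAB_eq_sum, ← mul_le_mul_iff_right₀ hl0, Finset.mul_sum, ← neg_le_neg_iff,
      ← Finset.sum_neg_distrib]
    simp only [mul_ite, mul_zero, neg_ite, neg_zero]
  rw [hset]
  refine (G.measure_le_sum_le hp _ _).trans (ENNReal.ofReal_le_ofReal (Real.exp_le_exp.2 ?_))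
  have hW := sum_edgeWeight A B
  have hsum : ∑ e, (Real.exp ((d + 1) * -(l * edgeWeight A B e)) - 1) ≤
      (A.card * B.card - (A ∩ B).card) * (s ^ 2 - s) := by
    rw [← hW, Finset.sum_mul]
    refine Finset.sum_le_sum fun e _ => ?_
    have h2 : (edgeWeight A B e : ℝ) ≤ 2 := mod_cast edgeWeight_le_two A B e
    have h0 : (0 : ℝ) ≤ edgeWeight A B e := Nat.cast_nonneg _
    have h3 : (d + 1) * -(l * edgeWeight A B e) = -(s * edgeWeight A B e) := by
      rw [hl]; field_simp
    rw [h3]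
    have h4 := exp_neg_le_quadratic (mul_nonneg hs.le h0)
    nlinarith [mul_nonneg (mul_nonneg h0 (sub_nonneg.2 h2)) (sq_nonneg s)]
  calc p / (d + 1) * ∑ e, (Real.exp ((d + 1) * -(l * edgeWeight A B e)) - 1) - -(l * y)
      ≤ p / (d + 1) * ((A.card * B.card - (A ∩ B).card) * (s ^ 2 - s)) - -(l * y) := by gcongr
    _ = (p * A.card * B.card * s ^ 2 - s * (p * A.card * B.card - p * (A ∩ B).card - y)) /
        (d + 1) - p * (A ∩ B).card * s ^ 2 / (d + 1) := by rw [hl]; field_simp; ring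
    _ ≤ _ := sub_le_self _ (by positivity)

theorem le_one_of_two_le (G : DepRandomGraph n p d) (hn : 2 ≤ n) : p ≤ 1 := by
  have h := prob_le_one (μ := G.μ)
    (s := {ω | G.X ⟨s(⟨0, by omega⟩, ⟨1, by omega⟩), by simp⟩ ω = true})
  rwa [G.probX, ENNReal.ofReal_le_one] at h

end DepRandomGraph

theorem mul_one_add_log_div_le {n x y : ℝ} (hx : 0 < x) (hxy : x ≤ y) (hyn : y ≤ n) :
    x * (1 + Real.log (n / x)) ≤ y * (1 + Real.log (n / y)) := by
  have hy := hx.trans_le hxy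
  have hn := hy.trans_le hyn
  have h1 : Real.log (n / x) = Real.log (n / y) + Real.log (y / x) := by
    rw [← Real.log_mul (by positivity) (by positivity)]
    congr 1
    field_simp
  have h2 : x * Real.log (y / x) ≤ y - x := by
    calc x * Real.log (y / x) ≤ x * (y / x - 1) :=
          mul_le_mul_of_nonneg_left (Real.log_le_sub_one_of_pos (by positivity)) hx.le
      _ = y - x := by field_simp
  have h3 : 0 ≤ Real.log (n / y) := Real.log_nonneg ((one_le_div hy).2 hyn)
  rw [h1]
  nlinarith [mul_nonneg (sub_nonneg.2 hxy) h3]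

theorem choose_le_exp_mul_one_add_log_div {n k : ℕ} (hk : k ≠ 0) (hkn : k ≤ n) :
    (n.choose k : ℝ) ≤ Real.exp (k * (1 + Real.log (n / k))) := by
  have hk0 : (0 : ℝ) < k := by positivity
  have hn0 : (0 : ℝ) < n := hk0.trans_le (mod_cast hkn)
  have h1 := Real.pow_div_factorial_le_exp (k : ℝ) hk0.le k
  calc (n.choose k : ℝ) ≤ n ^ k / k.factorial := Nat.choose_le_pow_div k n
    _ = (k ^ k / k.factorial) * (n / k) ^ k := by rw [div_pow]; field_simp
    _ ≤ Real.exp k * (n / k) ^ k := by gcongr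
    _ = _ := by
      rw [mul_add, mul_one, Real.exp_add, Real.exp_nat_mul (Real.log (n / k)),
        Real.exp_log (by positivity)]

theorem thirteen_sevenths_le_log : (13 / 7 : ℝ) ≤ Real.log (50 / 7) := by
  rw [Real.le_log_iff_exp_le (by norm_num)]
  refine le_of_pow_le_pow_left₀ (n := 7) (by norm_num) (by norm_num) ?_
  have h1 : Real.exp (13 / 7) ^ 7 = Real.exp 1 ^ 13 := by
    rw [← Real.exp_nat_mul, ← Real.exp_nat_mul]; norm_num
  rw [h1]
  calc Real.exp 1 ^ 13 ≤ 2.7182818286 ^ 13 :=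
        pow_le_pow_left₀ (Real.exp_pos 1).le Real.exp_one_lt_d9.le 13
    _ ≤ _ := by norm_num

theorem four_pow_mul_exp_le (n : ℕ) : (4 : ℝ) ^ n * Real.exp (-(5 / 2 * n)) ≤ Real.exp (-n) := by
  have h : (4 : ℝ) ≤ Real.exp (3 / 2) := by
    have h1 : Real.exp (3 / 2) = Real.exp 1 * Real.exp (1 / 2) := by
      rw [← Real.exp_add]; norm_num
    rw [h1]
    nlinarith [Real.exp_one_gt_d9, Real.add_one_le_exp (1 / 2 : ℝ)]
  calc (4 : ℝ) ^ n * Real.exp (-(5 / 2 * n)) ≤ Real.exp (3 / 2) ^ n * Real.exp (-(5 / 2 * n)) := by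
        gcongr
    _ = _ := by rw [← Real.exp_nat_mul, ← Real.exp_add]; congr 1; ring

theorem lower_exponent_le {C p a b i n k t : ℝ} (hC : 10 ≤ C) (hp : 0 < p) (hp1 : p ≤ 1)
    (ha : 0 < a) (hb : 0 < b) (hi : 0 ≤ i) (hia : i ≤ a) (hib : i ≤ b) (hn : 1 ≤ n) (hk : 1 ≤ k)
    (ht : t ^ 2 = C ^ 2 * (p * a * b) * n * k) :
    (p * a * b * (t / (2 * (p * a * b))) ^ 2 -
      t / (2 * (p * a * b)) * (p * a * b - p * i - (p * a * b - t))) / k ≤ -(5 / 2 * n) := by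
  have hm : 0 < p * a * b := by positivity
  have hk0 : 0 < k := by linarith
  have h1 : t * (p * i) ≤ C * n * (p * a * b) * k := by
    refine le_of_sq_le_sq ?_ (by positivity)
    have h2 : (p * i) ^ 2 ≤ n * (p * a * b) * k := by
      calc (p * i) ^ 2 = p * p * (i * i) := by ring
        _ ≤ 1 * p * (a * b) := by gcongr
        _ = 1 * (p * a * b) * 1 := by ring
        _ ≤ _ := by gcongr
    calc (t * (p * i)) ^ 2 = t ^ 2 * (p * i) ^ 2 := by ring
      _ ≤ t ^ 2 * (n * (p * a * b) * k) := by gcongr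
      _ = _ := by rw [ht]; ring
  generalize p * a * b = m at *
  have h2 : (m * (t / (2 * m)) ^ 2 - t / (2 * m) * (m - p * i - (m - t))) / k =
      (-t ^ 2 / 4 + t * (p * i) / 2) / (m * k) := by
    field_simp
    ring
  rw [h2, div_le_iff₀ (by positivity), ht]
  have h3 : 0 < n * (m * k) := by positivity
  nlinarith [mul_le_mul_of_nonneg_right hC h3.le,
    mul_le_mul_of_nonneg_right (mul_self_le_mul_self (by norm_num) hC) h3.le,
    mul_nonneg (mul_nonneg (sub_nonneg.2 hC) (by linarith : 0 ≤ C)) h3.le]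

theorem upper_exponent_le_of_le {C m n k t : ℝ} (hC : 10 ≤ C) (hm : 0 < m) (hn : 0 ≤ n)
    (hk : 0 < k) (ht0 : 0 ≤ t) (ht : t ^ 2 = C ^ 2 * m * n * k) (htm : t ≤ 2 * m) :
    (m * (Real.exp (t / (2 * m)) - 1) - t / (2 * m) * (m + t)) / (2 * k) ≤ -(5 / 2 * n) := by
  set s := t / (2 * m) with hs
  have hs0 : 0 ≤ s := by positivity
  have hs1 : s ≤ 1 := by rw [hs, div_le_one (by positivity)]; exact htm
  have h1 := (abs_le.1 (Real.abs_exp_sub_one_sub_id_le (abs_le.2 ⟨by linarith, hs1⟩))).2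
  have hts : t = s * (2 * m) := by rw [hs]; field_simp
  have h2 : m * (Real.exp s - 1) ≤ m * (s + s ^ 2) := by gcongr; linarith
  have h3 : 4 * m * s ^ 2 = C ^ 2 * n * k := by
    have : m * (4 * m * s ^ 2) = m * (C ^ 2 * n * k) := by
      rw [hts] at ht; linarith
    exact mul_left_cancel₀ hm.ne' this
  rw [div_le_iff₀ (by positivity)]
  have h4 : 100 * (n * k) ≤ C ^ 2 * n * k := by
    rw [mul_assoc]; gcongr; nlinarith
  rw [hts]
  have := mul_nonneg hn hk.le
  nlinarith

theorem upper_exponent_le_of_ge {m n k t : ℝ} (hm : 0 < m) (hk : 0 < k) (htm : 2 * m ≤ t)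
    (htn : 10 * n * k ≤ t) :
    (m * (Real.exp 1 - 1) - 1 * (m + t)) / (2 * k) ≤ -(5 / 2 * n) := by
  rw [div_le_iff₀ (by positivity)]
  nlinarith [Real.exp_one_lt_three]

theorem upper_exponent_le_of_mem {C m n k t a b : ℝ} (hC : 10 ≤ C) (hm : 0 < m) (hn : 0 < n)
    (hk : 0 < k) (ht : t ^ 2 = C ^ 2 * m * n * k) (htm : 2 * m ≤ t) (htn : t ≤ 10 * n * k)
    (ha : 0 < a) (hb : 0 < b) (hta : 14 * a * k ≤ t) (htb : 14 * b * k ≤ t) :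
    (m * (Real.exp (Real.log (t / m)) - 1) - Real.log (t / m) * (m + t)) / (2 * k) ≤
      -3 * (a * (1 + Real.log (n / a))) + -3 * (b * (1 + Real.log (n / b))) := by
  have ht0 : 0 < t := by linarith
  set z := t / (14 * k) with hz
  have hz0 : 0 < z := by positivity
  have htz : t = 14 * k * z := by rw [hz]; field_simp
  have hzn : z ≤ n := by
    rw [hz, div_le_iff₀ (by positivity)]
    nlinarith [mul_pos hn hk]
  have haz : a ≤ z := by
    rw [hz, le_div_iff₀ (by positivity)]
    linarith
  have hbz : b ≤ z := by
    rw [hz, le_div_iff₀ (by positivity)]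
    linarith
  have hga := mul_one_add_log_div_le ha haz hzn
  have hgb := mul_one_add_log_div_le hb hbz hzn
  have hL : 0 ≤ Real.log (n / z) := Real.log_nonneg ((one_le_div hz0).2 hzn)
  have htm' : 50 / 7 * (n / z) ≤ t / m := by
    have h1 : t / m = C ^ 2 * n * k / t := by
      rw [div_eq_div_iff hm.ne' ht0.ne', ← sq, ht]; ring
    have h2 : C ^ 2 * n * k / t = C ^ 2 / 14 * (n / z) := by
      rw [htz]; field_simp
    rw [h1, h2]
    refine mul_le_mul_of_nonneg_right ?_ (by positivity)
    nlinarith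
  have hlog : 13 / 7 + Real.log (n / z) ≤ Real.log (t / m) := by
    refine le_trans ?_ (Real.log_le_log (by positivity) htm')
    rw [Real.log_mul (by norm_num) (by positivity)]
    linarith [thirteen_sevenths_le_log]
  have hmt : m * (t / m) = t := by field_simp
  rw [Real.exp_log (by positivity), mul_sub, hmt]
  have key : (t - m * 1 - Real.log (t / m) * (m + t)) / (2 * k) ≤
      -6 * (z * (1 + Real.log (n / z))) := by
    rw [div_le_iff₀ (by positivity)]
    generalize Real.log (t / m) = s at *
    generalize Real.log (n / z) = L at *
    have h1 : 0 ≤ m * s := mul_nonneg hm.le (by linarith)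
    have h2 : t * (13 / 7 + L) ≤ t * s := by gcongr
    have h3 : 0 ≤ t * L := by positivity
    have h4 : -6 * (z * (1 + L)) * (2 * k) = -(6 / 7) * (t * (1 + L)) := by rw [htz]; ring
    rw [h4]
    nlinarith
  linarith

/-- The weight of a set of size `a` in the union bound over pairs of sets of vertices. -/
noncomputable def unionBoundWeight (n a : ℕ) : ℝ :=
  if a = 0 then 0 else Real.exp (-3 * (a * (1 + Real.log (n / a))))

theorem unionBoundWeight_nonneg (n a : ℕ) : 0 ≤ unionBoundWeight n a := by
  unfold unionBoundWeight
  split_ifs <;> positivity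

theorem sum_unionBoundWeight_le {n : ℕ} (hn : n ≠ 0) :
    ∑ A : Finset (Fin n), unionBoundWeight n A.card ≤ 2 / n := by
  have hn1 : (1 : ℝ) ≤ n := by exact_mod_cast Nat.one_le_iff_ne_zero.2 hn
  have hterm (k : ℕ) (hk : k ∈ Finset.range (n + 1)) :
      n.choose k • unionBoundWeight n k ≤ 1 / (n : ℝ) ^ 2 := by
    have hkn : k ≤ n := Nat.lt_succ_iff.1 (Finset.mem_range.1 hk)
    unfold unionBoundWeight
    split_ifs with h0
    · simp
    · have hk1 : (1 : ℝ) ≤ k := by exact_mod_cast Nat.one_le_iff_ne_zero.2 h0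
      have hg := mul_one_add_log_div_le one_pos hk1 (Nat.cast_le.2 hkn)
      rw [div_one, one_mul] at hg
      rw [nsmul_eq_mul]
      calc (n.choose k : ℝ) * Real.exp (-3 * (k * (1 + Real.log (n / k))))
          ≤ Real.exp (k * (1 + Real.log (n / k))) *
              Real.exp (-3 * (k * (1 + Real.log (n / k)))) := by
            gcongr
            exact choose_le_exp_mul_one_add_log_div h0 hkn
        _ = Real.exp (-2 * (k * (1 + Real.log (n / k)))) := by
            rw [← Real.exp_add]; congr 1; ring
        _ ≤ Real.exp (-(2 * Real.log n)) := by
            gcongr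
            linarith
        _ = 1 / (n : ℝ) ^ 2 := by
            rw [Real.exp_neg, two_mul, Real.exp_add, Real.exp_log (by linarith), one_div, sq]
  rw [← Finset.powerset_univ, Finset.sum_powerset_apply_card, Finset.card_univ, Fintype.card_fin]
  calc _ ≤ (Finset.range (n + 1)).card • (1 / (n : ℝ) ^ 2) := Finset.sum_le_card_nsmul _ _ _ hterm
    _ = (n + 1) / (n : ℝ) ^ 2 := by simp [div_eq_mul_inv]
    _ ≤ (n + n) / (n : ℝ) ^ 2 := by gcongr
    _ = 2 / n := by field_simp; ring

namespace DepRandomGraph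

variable {n : ℕ} {p : ℝ} {d : ℕ}

theorem measure_lt_eAB_le (G : DepRandomGraph n p d) {C : ℝ} (hC : 10 ≤ C) (hn : n ≠ 0)
    (hp : 0 < p) {A B : Finset (Fin n)} (hA : A.Nonempty) (hB : B.Nonempty) {t : ℝ} (ht0 : 0 ≤ t)
    (ht : t ^ 2 = C ^ 2 * (p * A.card * B.card) * n * (d + 1)) :
    G.μ {ω | (∀ v, (G.deg ω v : ℝ) ≤ C ^ 2 / 14 * n * p) ∧
        p * A.card * B.card + t < (G.eAB ω A B : ℝ)} ≤
      ENNReal.ofReal (Real.exp (-(5 / 2 * n)) +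
        unionBoundWeight n A.card * unionBoundWeight n B.card) := by
  have ha : (0 : ℝ) < A.card := by exact_mod_cast hA.card_pos
  have hb : (0 : ℝ) < B.card := by exact_mod_cast hB.card_pos
  have hn0 : (0 : ℝ) < n := by positivity
  have hk : (0 : ℝ) < d + 1 := by positivity
  have hm : 0 < p * A.card * B.card := by positivity
  have hweight := mul_nonneg (unionBoundWeight_nonneg n A.card) (unionBoundWeight_nonneg n B.card)
  have hempty {a b : ℝ} (ha : 0 < a) (hb : 0 < b) (hab : p * A.card * B.card = p * a * b)
      (htb : t < 14 * b * (d + 1)) (he : ∀ ω, (∀ v, (G.deg ω v : ℝ) ≤ C ^ 2 / 14 * n * p) →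
        (G.eAB ω A B : ℝ) ≤ a * (C ^ 2 / 14 * n * p)) :
      {ω | (∀ v, (G.deg ω v : ℝ) ≤ C ^ 2 / 14 * n * p) ∧
        p * A.card * B.card + t < (G.eAB ω A B : ℝ)} = ∅ := by
    rw [Set.eq_empty_iff_forall_notMem]
    rintro ω ⟨hdeg, hlt⟩
    have h1 := he ω hdeg
    have h2 : a * (C ^ 2 / 14 * n * p) * (14 * b * (d + 1)) ≤ t * (14 * b * (d + 1)) := by
      calc a * (C ^ 2 / 14 * n * p) * (14 * b * (d + 1)) = t ^ 2 := by rw [ht, hab]; ring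
        _ = t * t := sq t
        _ ≤ _ := by gcongr
    have h3 := le_of_mul_le_mul_right h2 (by positivity)
    linarith
  by_cases hta : t < 14 * A.card * (d + 1)
  · rw [hempty hb ha (by ring) hta fun ω hω => by
      rw [eAB_comm]; exact G.eAB_le_card_mul ω B A hω]
    simp
  by_cases htb : t < 14 * B.card * (d + 1)
  · rw [hempty ha hb rfl htb fun ω hω => G.eAB_le_card_mul ω A B hω]
    simp
  rw [not_lt] at hta htb
  have hsub {s : ℝ} (hs : 0 ≤ s) : G.μ {ω | (∀ v, (G.deg ω v : ℝ) ≤ C ^ 2 / 14 * n * p) ∧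
        p * A.card * B.card + t < (G.eAB ω A B : ℝ)} ≤ ENNReal.ofReal (Real.exp
      ((p * A.card * B.card * (Real.exp s - 1) - s * (p * A.card * B.card + t)) /
        (2 * (d + 1)))) :=
    (measure_mono fun ω hω => hω.2.le).trans (G.measure_le_eAB_le hp.le A B _ hs)
  rcases le_total t (2 * (p * A.card * B.card)) with htm | htm
  · refine (hsub (s := t / (2 * (p * A.card * B.card))) (by positivity)).trans
      (ENNReal.ofReal_le_ofReal ?_)
    have := Real.exp_le_exp.2 (upper_exponent_le_of_le hC hm hn0.le hk ht0 ht htm)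
    linarith
  rcases le_total t (10 * n * (d + 1)) with htn | htn
  · have hs : 0 ≤ Real.log (t / (p * A.card * B.card)) :=
      Real.log_nonneg ((one_le_div hm).2 (by linarith))
    refine (hsub hs).trans (ENNReal.ofReal_le_ofReal ?_)
    have := Real.exp_le_exp.2 (upper_exponent_le_of_mem hC hm hn0 hk ht htm htn ha hb hta htb)
    rw [Real.exp_add] at this
    rw [unionBoundWeight, unionBoundWeight, if_neg hA.card_ne_zero, if_neg hB.card_ne_zero]
    linarith [Real.exp_pos (-(5 / 2 * (n : ℝ)))]
  · refine (hsub zero_le_one).trans (ENNReal.ofReal_le_ofReal ?_)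
    have := Real.exp_le_exp.2 (upper_exponent_le_of_ge hm hk htm htn)
    linarith

theorem measure_eAB_lt_le (G : DepRandomGraph n p d) {C : ℝ} (hC : 10 ≤ C) (hn : 2 ≤ n)
    (hp : 0 < p) {A B : Finset (Fin n)} (hA : A.Nonempty) (hB : B.Nonempty) {t : ℝ} (ht0 : 0 ≤ t)
    (ht : t ^ 2 = C ^ 2 * (p * A.card * B.card) * n * (d + 1)) :
    G.μ {ω | (G.eAB ω A B : ℝ) < p * A.card * B.card - t} ≤
      ENNReal.ofReal (Real.exp (-(5 / 2 * n))) := by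
  have ha : (0 : ℝ) < A.card := by exact_mod_cast hA.card_pos
  have hb : (0 : ℝ) < B.card := by exact_mod_cast hB.card_pos
  refine (measure_mono (Set.ofPred_subset_ofPred.2 fun ω hω => le_of_lt hω)).trans
    ((G.measure_eAB_le_le hp.le A B _
    (s := t / (2 * (p * A.card * B.card))) (by positivity)).trans
      (ENNReal.ofReal_le_ofReal (Real.exp_le_exp.2 ?_)))
  refine lower_exponent_le hC hp (G.le_one_of_two_le hn) ha hb (Nat.cast_nonneg _)
    (Nat.cast_le.2 (Finset.card_le_card Finset.inter_subset_left))
    (Nat.cast_le.2 (Finset.card_le_card Finset.inter_subset_right)) ?_ ?_ ht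
  · exact_mod_cast (by omega : 1 ≤ n)
  · linarith [Nat.cast_nonneg (α := ℝ) d]

theorem measure_not_jumbled_pair_le (G : DepRandomGraph n p d) {C : ℝ} (hC : 10 ≤ C) (hn : 2 ≤ n)
    (hp : 0 ≤ p) (A B : Finset (Fin n)) :
    G.μ {ω | (∀ v, (G.deg ω v : ℝ) ≤ C ^ 2 / 14 * n * p) ∧
        ¬ |(G.eAB ω A B : ℝ) - p * A.card * B.card| ≤
          C * Real.sqrt ((A.card : ℝ) * B.card * n * p * ((d : ℝ) + 1))} ≤
      ENNReal.ofReal (2 * Real.exp (-(5 / 2 * n)) +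
        unionBoundWeight n A.card * unionBoundWeight n B.card) := by
  set t := C * Real.sqrt ((A.card : ℝ) * B.card * n * p * ((d : ℝ) + 1)) with ht
  have hC0 : 0 ≤ C := by linarith
  have ht0 : 0 ≤ t := by positivity
  have htsq : t ^ 2 = C ^ 2 * (p * A.card * B.card) * n * (d + 1) := by
    rw [ht, mul_pow, Real.sq_sqrt (by positivity)]; ring
  have hdegenerate (hμ : p * A.card * B.card = 0) (he : ∀ ω,
      (∀ v, (G.deg ω v : ℝ) ≤ C ^ 2 / 14 * n * p) → (G.eAB ω A B : ℝ) ≤ 0) :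
      {ω | (∀ v, (G.deg ω v : ℝ) ≤ C ^ 2 / 14 * n * p) ∧
        ¬ |(G.eAB ω A B : ℝ) - p * A.card * B.card| ≤ t} = ∅ := by
    rw [Set.eq_empty_iff_forall_notMem]
    rintro ω ⟨hdeg, hlt⟩
    have h0 : (G.eAB ω A B : ℝ) = 0 := (he ω hdeg).antisymm (Nat.cast_nonneg _)
    rw [h0, hμ, sub_zero, abs_zero] at hlt
    exact hlt ht0
  rcases hp.eq_or_lt with rfl | hp
  · rw [hdegenerate (by ring) fun ω hω => by simpa using G.eAB_le_card_mul ω A B hω]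
    simp
  rcases A.eq_empty_or_nonempty with rfl | hA
  · rw [hdegenerate (by simp) fun ω hω => by simpa using G.eAB_le_card_mul ω ∅ B hω]
    simp
  rcases B.eq_empty_or_nonempty with rfl | hB
  · rw [hdegenerate (by simp) fun ω hω => by
      rw [eAB_comm]; simpa using G.eAB_le_card_mul ω ∅ A hω]
    simp
  have hweight := mul_nonneg (unionBoundWeight_nonneg n A.card) (unionBoundWeight_nonneg n B.card)
  have hexp := Real.exp_pos (-(5 / 2 * (n : ℝ)))
  calc _ ≤ G.μ ({ω | (∀ v, (G.deg ω v : ℝ) ≤ C ^ 2 / 14 * n * p) ∧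
          p * A.card * B.card + t < (G.eAB ω A B : ℝ)} ∪
        {ω | (G.eAB ω A B : ℝ) < p * A.card * B.card - t}) := by
        refine measure_mono ?_
        rintro ω ⟨hdeg, hlt⟩
        rw [not_le, lt_abs] at hlt
        rcases hlt with h | h
        · exact Or.inl ⟨hdeg, by linarith⟩
        · exact Or.inr (show (G.eAB ω A B : ℝ) < p * A.card * B.card - t by linarith)
    _ ≤ _ := measure_union_le _ _
    _ ≤ _ := add_le_add (G.measure_lt_eAB_le hC (by omega) hp hA hB ht0 htsq)
        (G.measure_eAB_lt_le hC hn hp hA hB ht0 htsq)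
    _ = _ := by
        rw [← ENNReal.ofReal_add (by positivity) hexp.le]
        congr 1
        ring

theorem measure_maxDegree_le_add (G : DepRandomGraph n p d) {C : ℝ} (hC : 10 ≤ C) (hn : 2 ≤ n)
    (hp : 0 ≤ p) :
    G.μ {ω | ∀ v, (G.deg ω v : ℝ) ≤ C ^ 2 / 14 * n * p} ≤
      G.μ {ω | ∀ A B : Finset (Fin n), |(G.eAB ω A B : ℝ) - p * A.card * B.card| ≤
        C * Real.sqrt ((A.card : ℝ) * B.card * n * p * ((d : ℝ) + 1))} +
      ENNReal.ofReal (2 * Real.exp (-n) + (2 / n) ^ 2) := by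
  set bad : Finset (Fin n) → Finset (Fin n) → Set G.Ω := fun A B =>
    {ω | (∀ v, (G.deg ω v : ℝ) ≤ C ^ 2 / 14 * n * p) ∧
      ¬ |(G.eAB ω A B : ℝ) - p * A.card * B.card| ≤
        C * Real.sqrt ((A.card : ℝ) * B.card * n * p * ((d : ℝ) + 1))} with hbad
  have hnonneg (A B : Finset (Fin n)) : 0 ≤ 2 * Real.exp (-(5 / 2 * (n : ℝ))) +
      unionBoundWeight n A.card * unionBoundWeight n B.card :=
    add_nonneg (by positivity)
      (mul_nonneg (unionBoundWeight_nonneg _ _) (unionBoundWeight_nonneg _ _))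
  have hunion : G.μ (⋃ A, ⋃ B, bad A B) ≤ ENNReal.ofReal (2 * Real.exp (-n) + (2 / n) ^ 2) := by
    calc G.μ (⋃ A, ⋃ B, bad A B) ≤ ∑ A, ∑ B, G.μ (bad A B) :=
          (measure_iUnion_fintype_le _ _).trans
            (Finset.sum_le_sum fun A _ => measure_iUnion_fintype_le _ _)
      _ ≤ ∑ A : Finset (Fin n), ∑ B : Finset (Fin n),
          ENNReal.ofReal (2 * Real.exp (-(5 / 2 * (n : ℝ))) +
            unionBoundWeight n A.card * unionBoundWeight n B.card) :=
          Finset.sum_le_sum fun A _ => Finset.sum_le_sum fun B _ =>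
            G.measure_not_jumbled_pair_le hC hn hp A B
      _ = ENNReal.ofReal (2 * ((4 : ℝ) ^ n * Real.exp (-(5 / 2 * (n : ℝ)))) +
            (∑ A : Finset (Fin n), unionBoundWeight n A.card) ^ 2) := by
          simp_rw [← ENNReal.ofReal_sum_of_nonneg fun B _ => hnonneg _ B]
          rw [← ENNReal.ofReal_sum_of_nonneg fun A _ => Finset.sum_nonneg fun B _ => hnonneg A B]
          simp only [Finset.sum_add_distrib, ← Finset.mul_sum, ← Finset.sum_mul, Finset.sum_const,
            Finset.card_univ, Fintype.card_finset, Fintype.card_fin, nsmul_eq_mul]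
          congr 1
          rw [show (4 : ℝ) = 2 * 2 by norm_num, mul_pow]
          push_cast
          ring
      _ ≤ _ := by
          refine ENNReal.ofReal_le_ofReal (add_le_add ?_ (pow_le_pow_left₀ ?_ ?_ 2))
          · exact mul_le_mul_of_nonneg_left (four_pow_mul_exp_le n) zero_le_two
          · exact Finset.sum_nonneg fun A _ => unionBoundWeight_nonneg _ _
          · exact sum_unionBoundWeight_le (by omega)
  refine le_trans (measure_mono fun ω hω => ?_)
    ((measure_union_le _ (⋃ A, ⋃ B, bad A B)).trans (add_le_add_right hunion _))
  by_cases h : ω ∈ ⋃ A, ⋃ B, bad A B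
  · exact Or.inr h
  · refine Or.inl fun A B => ?_
    by_contra hAB
    exact h (Set.mem_iUnion₂.2 ⟨A, B, hω, hAB⟩)

end DepRandomGraph

/-- **Jumbledness.** Fix `C ≥ 10`. If a sequence of `d(n)`-dependent random graph
distributions almost surely has maximum degree at most `(C²/14) n p`, then almost surely
every pair of vertex subsets `A, B` satisfies
`|e(A,B) − p|A||B|| ≤ C √(|A||B| n p (d+1))`. -/
theorem jumbledness (C : ℝ) (hC : 10 ≤ C) (p : ℕ → ℝ) (d : ℕ → ℕ)
    (G : (n : ℕ) → DepRandomGraph n (p n) (d n))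
    (hmax : Tendsto
      (fun n : ℕ => (G n).μ {ω | ∀ v : Fin n, ((G n).deg ω v : ℝ) ≤ C ^ 2 / 14 * n * p n})
      atTop (nhds 1)) :
    Tendsto
      (fun n : ℕ => (G n).μ {ω | ∀ A B : Finset (Fin n),
          |((G n).eAB ω A B : ℝ) - p n * A.card * B.card| ≤
            C * Real.sqrt ((A.card : ℝ) * B.card * n * p n * ((d n : ℝ) + 1))})
      atTop (nhds 1) := by
  have herr : Tendsto (fun n : ℕ => ENNReal.ofReal (2 * Real.exp (-n) + (2 / n) ^ 2))
      atTop (nhds 0) := by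
    have h1 : Tendsto (fun n : ℕ => Real.exp (-n)) atTop (nhds 0) :=
      Real.tendsto_exp_neg_atTop_nhds_zero.comp tendsto_natCast_atTop_atTop
    have h2 : Tendsto (fun n : ℕ => (2 : ℝ) / n) atTop (nhds 0) :=
      tendsto_const_div_atTop_nhds_zero_nat 2
    simpa using ENNReal.tendsto_ofReal ((h1.const_mul 2).add (h2.pow 2))
  have hsub := ENNReal.Tendsto.sub hmax herr (Or.inl ENNReal.one_ne_top)
  rw [tsub_zero] at hsub
  refine tendsto_of_tendsto_of_tendsto_of_le_of_le' hsub tendsto_const_nhds ?_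
    (Eventually.of_forall fun n => prob_le_one)
  filter_upwards [hmax.eventually (lt_mem_nhds zero_lt_one), eventually_ge_atTop 2] with n hpos hn
  obtain ⟨ω, hω⟩ := nonempty_of_measure_ne_zero hpos.ne'
  have hp : 0 ≤ p n := by
    have h1 : 0 ≤ C ^ 2 / 14 * n * p n := (Nat.cast_nonneg _).trans (hω ⟨0, by omega⟩)
    have hn0 : (0 : ℝ) < n := by exact_mod_cast (by omega : 0 < n)
    exact nonneg_of_mul_nonneg_right h1 (by positivity)
  exact tsub_le_iff_right.2 ((G n).measure_maxDegree_le_add hC hn hp)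
end

section
/- Let f(n) be any function with f(n) → ∞, and let p = p(n) and d = d(n) be sequences with p(n) > (d(n)+1)·(ln(n) + f(n))/n for all n. Then for any sequence of d(n)-dependent random graph distributions G ~ G_{n,p(n),d(n)} on n vertices, the probability that G is connected tends to 1 as n → ∞. -/
open MeasureTheory ProbabilityTheory Filter

/-- The potential edges joining a vertex of `S` to a vertex outside `S`. -/
noncomputable def cutEdges {n : ℕ} (S : Finset (Fin n)) : Finset (EdgeIdx n) :=
  open Classical in Finset.univ.filter fun e => ∃ a ∈ S, ∃ b ∉ S, e.1 = s(a, b)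

lemma mem_cutEdges {n : ℕ} {S : Finset (Fin n)} {e : EdgeIdx n} :
    e ∈ cutEdges S ↔ ∃ a ∈ S, ∃ b ∉ S, e.1 = s(a, b) := by
  simp [cutEdges]

lemma card_mul_card_compl_le_card_cutEdges {n : ℕ} (S : Finset (Fin n)) :
    S.card * Sᶜ.card ≤ (cutEdges S).card := by
  classical
  rw [← Finset.card_product, ← Finset.card_image_of_injective _ Subtype.val_injective]
  refine Finset.card_le_card_of_injOn (fun q => s(q.1, q.2)) ?_ ?_
  · rintro ⟨a, b⟩ h
    simp only [Finset.coe_product, Set.mem_prod, Finset.mem_coe, Finset.mem_compl] at h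
    have hab : a ≠ b := fun hab => h.2 (hab ▸ h.1)
    simp only [Finset.coe_image, Set.mem_image, Finset.mem_coe]
    exact ⟨⟨s(a, b), by simpa using hab⟩, mem_cutEdges.2 ⟨a, h.1, b, h.2, rfl⟩, rfl⟩
  · rintro ⟨a, b⟩ h ⟨a', b'⟩ h' heq
    simp only [Finset.coe_product, Set.mem_prod, Finset.mem_coe, Finset.mem_compl] at h h'
    simp only [Sym2.eq_iff] at heq
    rcases heq with ⟨rfl, rfl⟩ | ⟨rfl, rfl⟩
    · rfl
    · exact absurd h.1 h'.2

lemma SimpleGraph.exists_card_le_half_of_not_connected {n : ℕ} (hn : 0 < n)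
    (H : SimpleGraph (Fin n)) (hH : ¬ H.Connected) :
    ∃ S : Finset (Fin n), 1 ≤ S.card ∧ 2 * S.card ≤ n ∧
      ∀ a ∈ S, ∀ b ∉ S, ¬ H.Adj a b := by
  classical
  have : Nonempty (Fin n) := ⟨⟨0, hn⟩⟩
  have hpre : ¬ H.Preconnected := fun h => hH ⟨h⟩
  simp only [SimpleGraph.Preconnected, not_forall] at hpre
  obtain ⟨u, v, huv⟩ := hpre
  set S : Finset (Fin n) := Finset.univ.filter (H.Reachable u) with hS
  have hmem : ∀ x, x ∈ S ↔ H.Reachable u x := by simp [hS]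
  have hcut : ∀ a ∈ S, ∀ b ∉ S, ¬ H.Adj a b := fun a ha b hb hab =>
    hb ((hmem b).2 (((hmem a).1 ha).trans hab.reachable))
  have hcard : S.card + Sᶜ.card = n := by simp
  by_cases h : 2 * S.card ≤ n
  · exact ⟨S, Finset.card_pos.2 ⟨u, (hmem u).2 .rfl⟩, h, hcut⟩
  · refine ⟨Sᶜ, Finset.card_pos.2 ⟨v, ?_⟩, by omega, fun a ha b hb hab => ?_⟩
    · simp [hmem, huv]
    · rw [Finset.mem_compl] at ha hb
      exact hcut b (not_not.1 hb) a ha hab.symm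

namespace DepRandomGraph

variable {n : ℕ} {p : ℝ} {d : ℕ} (G : DepRandomGraph n p d)

lemma measureReal_eq_false (hp : 0 ≤ p) (e : EdgeIdx n) :
    G.μ.real {ω | G.X e ω = false} = 1 - p := by
  have hm : MeasurableSet {ω | G.X e ω = true} :=
    G.meas e (t := {true}) trivial
  have hc : {ω | G.X e ω = false} = {ω | G.X e ω = true}ᶜ := by ext; simp
  rw [hc, measureReal_compl hm, probReal_univ, measureReal_def, G.probX, ENNReal.toReal_ofReal hp]

lemma measureReal_forall_eq_false_le (hp : 0 ≤ p) (E : Finset (EdgeIdx n)) :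
    G.μ.real {ω | ∀ e ∈ E, G.X e ω = false} ≤ Real.exp (-(p / (d + 1) * E.card)) := by
  classical
  induction E using Finset.strongInduction with
  | H E ih =>
  rcases E.eq_empty_or_nonempty with rfl | ⟨e, he⟩
  · simp
  set N : Finset (EdgeIdx n) := insert e (G.D.neighborSet e).toFinset with hN
  have hNcard : N.card ≤ d + 1 := by
    refine (Finset.card_insert_le _ _).trans ?_
    rw [← Set.ncard_eq_toFinset_card']
    exact Nat.add_le_add_right (G.degBound e) 1
  have hcard : (E.card : ℝ) ≤ (d + 1) + (E \ N).card := by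
    have := Finset.card_le_card_sdiff_add_card (s := E) (t := N)
    exact_mod_cast (by omega : E.card ≤ (d + 1) + (E \ N).card)
  have hss : E \ N ⊂ E := Finset.ssubset_iff_subset_ne.2
    ⟨Finset.sdiff_subset, fun h => (Finset.mem_sdiff.1 (h.symm ▸ he)).2 (by simp [hN])⟩
  set A := {ω | G.X e ω = false}
  set B := {ω | ∀ f ∈ E \ N, G.X f ω = false} with hB
  have hA : MeasurableSet[MeasurableSpace.comap (G.X e) ⊤] A := ⟨{false}, trivial, rfl⟩
  have hBm : MeasurableSet[⨆ f ∈ {f : EdgeIdx n | f ≠ e ∧ ¬ G.D.Adj e f},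
      MeasurableSpace.comap (G.X f) ⊤] B := by
    have : B = ⋂ f ∈ E \ N, {ω | G.X f ω = false} := by ext; simp [hB]
    rw [this]
    refine Finset.measurableSet_biInter _ fun f hf => ?_
    have hf' : f ∈ {f : EdgeIdx n | f ≠ e ∧ ¬ G.D.Adj e f} := by
      simpa [hN] using (Finset.mem_sdiff.1 hf).2
    exact le_iSup₂ (f := fun f (_ : f ∈ {f : EdgeIdx n | f ≠ e ∧ ¬ G.D.Adj e f}) =>
      MeasurableSpace.comap (G.X f) ⊤) f hf' _ ⟨{false}, trivial, rfl⟩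
  have hind : G.μ.real (A ∩ B) = G.μ.real A * G.μ.real B := by
    have := (Indep_iff _ _ _).1 (G.indep e) A B hA hBm
    simp [measureReal_def, this]
  calc G.μ.real {ω | ∀ f ∈ E, G.X f ω = false}
      ≤ G.μ.real (A ∩ B) := measureReal_mono fun ω hω =>
        ⟨hω e he, fun f hf => hω f (Finset.mem_sdiff.1 hf).1⟩
    _ = (1 - p) * G.μ.real B := by rw [hind, G.measureReal_eq_false hp]
    _ ≤ Real.exp (-p) * Real.exp (-(p / (d + 1) * (E \ N).card)) := by
        gcongr
        · exact Real.one_sub_le_exp_neg p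
        · exact ih _ hss
    _ ≤ Real.exp (-(p / (d + 1) * E.card)) := by
        rw [← Real.exp_add, Real.exp_le_exp]
        have h := mul_le_mul_of_nonneg_left hcard (by positivity : 0 ≤ p / ((d : ℝ) + 1))
        have h2 : p / ((d : ℝ) + 1) * (d + 1) = p := by field_simp
        rw [mul_add, h2] at h
        linarith

end DepRandomGraph

lemma Nat.choose_le_exp {n k : ℕ} (hk : 1 ≤ k) (hkn : k ≤ n) :
    (n.choose k : ℝ) ≤ Real.exp (k * (1 + Real.log n - Real.log k)) := by
  have hk0 : (0 : ℝ) < k := by exact_mod_cast hk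
  have hn0 : (0 : ℝ) < n := by exact_mod_cast hk.trans hkn
  have hfac : (0 : ℝ) < k.factorial := by exact_mod_cast k.factorial_pos
  have h1 : (n.choose k : ℝ) ≤ (n : ℝ) ^ k / k.factorial := Nat.choose_le_pow_div k n
  have h2 : (k : ℝ) ^ k / k.factorial ≤ Real.exp k := Real.pow_div_factorial_le_exp _ hk0.le k
  have h3 : Real.exp (k * (1 + Real.log n - Real.log k)) =
      Real.exp k * ((n : ℝ) ^ k / (k : ℝ) ^ k) := by
    rw [mul_sub, mul_add, mul_one, Real.exp_sub, Real.exp_add, Real.exp_nat_mul, Real.exp_nat_mul,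
      Real.exp_log hn0, Real.exp_log hk0, mul_div_assoc]
  rw [h3]
  calc (n.choose k : ℝ) ≤ (k : ℝ) ^ k / k.factorial * ((n : ℝ) ^ k / (k : ℝ) ^ k) := by
        refine h1.trans_eq ?_
        field_simp
    _ ≤ _ := by gcongr

lemma Real.div_mul_log_le_log_add_one {x y : ℝ} (hx : 1 ≤ x) (hxy : x ≤ y) :
    x / y * Real.log y ≤ Real.log x + 1 := by
  have hx0 : 0 < x := by linarith
  have hy0 : 0 < y := by linarith
  have h1 : Real.log (y / x) ≤ y / x - 1 := Real.log_le_sub_one_of_pos (by positivity)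
  rw [Real.log_div hy0.ne' hx0.ne'] at h1
  have h2 : x / y ≤ 1 := (div_le_one hy0).2 hxy
  have h3 : x / y * (y / x) = 1 := by field_simp
  have h4 : 0 < x / y := by positivity
  have h5 := mul_le_mul_of_nonneg_left h1 h4.le
  nlinarith [Real.log_nonneg hx]

lemma Nat.choose_mul_exp_le {n k : ℕ} (hk : 1 ≤ k) (hkn : 2 * k ≤ n) {a c : ℝ} (hc : 0 ≤ c)
    (ha : (Real.log n + c) / n ≤ a) :
    (n.choose k : ℝ) * Real.exp (-(a * (k * (n - k)))) ≤ Real.exp (2 - c / 2) ^ k := by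
  have hk0 : (1 : ℝ) ≤ k := by exact_mod_cast hk
  have hkn' : 2 * (k : ℝ) ≤ n := by exact_mod_cast hkn
  have hn0 : (0 : ℝ) < n := by linarith
  rw [← Real.exp_nat_mul]
  refine (mul_le_mul_of_nonneg_right (Nat.choose_le_exp hk (by omega)) (Real.exp_pos _).le).trans ?_
  rw [← Real.exp_add, Real.exp_le_exp]
  have h1 := Real.div_mul_log_le_log_add_one hk0 (by linarith : (k : ℝ) ≤ n)
  have h2 : (Real.log n + c) / n * (k * (n - k)) ≤ a * (k * (n - k)) :=
    mul_le_mul_of_nonneg_right ha (mul_nonneg (by linarith) (by linarith))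
  have h3 : (Real.log n + c) / n * (k * (n - k)) = k * ((1 - k / n) * (Real.log n + c)) := by
    field_simp
  have h4 : (k : ℝ) / n ≤ 1 / 2 := by rw [div_le_div_iff₀ hn0 two_pos]; linarith
  have h5 : (1 / 2) * c ≤ (1 - (k : ℝ) / n) * c := by gcongr; linarith
  have h6 : 1 + Real.log n - Real.log k - (1 - k / n) * (Real.log n + c) ≤ 2 - c / 2 := by
    linarith
  have h7 := mul_le_mul_of_nonneg_left h6 (by linarith : (0 : ℝ) ≤ k)
  linarith

namespace DepRandomGraph

variable {n : ℕ} {p : ℝ} {d : ℕ} (G : DepRandomGraph n p d)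

lemma forall_cutEdges_eq_false {ω : G.Ω} {S : Finset (Fin n)}
    (h : ∀ a ∈ S, ∀ b ∉ S, ¬ (G.graph ω).Adj a b) (e : EdgeIdx n) (he : e ∈ cutEdges S) :
    G.X e ω = false := by
  obtain ⟨a, ha, b, hb, hab⟩ := mem_cutEdges.1 he
  by_contra hX
  refine h a ha b hb ?_
  rw [graph, SimpleGraph.fromEdgeSet_adj]
  refine ⟨⟨hab ▸ e.2, ?_⟩, fun h => hb (h ▸ ha)⟩
  have : e = ⟨s(a, b), hab ▸ e.2⟩ := Subtype.ext hab
  rw [← this]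
  simpa using hX

lemma measureReal_not_connected_le (hn : 0 < n) {c : ℝ} (hc : 0 ≤ c)
    (hp : (d + 1) * (Real.log n + c) / n ≤ p) (hr : Real.exp (2 - c / 2) ≤ 1 / 2) :
    G.μ.real {ω | ¬ (G.graph ω).Connected} ≤ 2 * Real.exp (2 - c / 2) := by
  classical
  set r := Real.exp (2 - c / 2)
  have hr0 : 0 < r := Real.exp_pos _
  have hn1 : (1 : ℝ) ≤ n := by exact_mod_cast hn
  have hp0 : 0 ≤ p := le_trans (by have := Real.log_nonneg hn1; positivity) hp
  set a := p / ((d : ℝ) + 1)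
  have ha0 : 0 ≤ a := by positivity
  have ha : (Real.log n + c) / n ≤ a := by
    rw [le_div_iff₀ (by positivity)]
    refine le_trans (le_of_eq ?_) hp
    ring
  let g : ℕ → ℝ := fun k => if 1 ≤ k ∧ 2 * k ≤ n then Real.exp (-(a * (k * (n - k)))) else 0
  let T : Finset (Finset (Fin n)) := Finset.univ.filter fun S => 1 ≤ S.card ∧ 2 * S.card ≤ n
  have hterm (k : ℕ) : n.choose (k + 1) • g (k + 1) ≤ r ^ (k + 1) := by
    simp only [g, nsmul_eq_mul]
    split_ifs with h
    · exact Nat.choose_mul_exp_le h.1 h.2 hc ha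
    · simpa using (pow_pos hr0 (k + 1)).le
  calc G.μ.real {ω | ¬ (G.graph ω).Connected}
      ≤ G.μ.real (⋃ S ∈ T, {ω | ∀ e ∈ cutEdges S, G.X e ω = false}) := by
        refine measureReal_mono (fun ω hω => ?_) (measure_ne_top _ _)
        obtain ⟨S, h1, h2, h3⟩ := SimpleGraph.exists_card_le_half_of_not_connected hn _ hω
        simp only [Set.mem_iUnion]
        exact ⟨S, Finset.mem_filter.2 ⟨Finset.mem_univ _, h1, h2⟩, G.forall_cutEdges_eq_false h3⟩
    _ ≤ ∑ S ∈ T, G.μ.real {ω | ∀ e ∈ cutEdges S, G.X e ω = false} :=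
        measureReal_biUnion_finset_le _ _
    _ ≤ ∑ S ∈ T, Real.exp (-(a * (S.card * (n - S.card)))) := by
        refine Finset.sum_le_sum fun S _ =>
          (G.measureReal_forall_eq_false_le hp0 _).trans ?_
        rw [Real.exp_le_exp, neg_le_neg_iff]
        refine mul_le_mul_of_nonneg_left ?_ ha0
        have hcard : (S.card : ℝ) + Sᶜ.card = n := by
          exact_mod_cast (by simp : S.card + Sᶜ.card = n)
        rw [← hcard, add_sub_cancel_left]
        exact_mod_cast card_mul_card_compl_le_card_cutEdges S
    _ = ∑ S ∈ (Finset.univ : Finset (Fin n)).powerset, g S.card := by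
        rw [Finset.powerset_univ, Finset.sum_filter]
    _ = ∑ k ∈ Finset.range n, n.choose (k + 1) • g (k + 1) := by
        rw [Finset.sum_powerset_apply_card, Finset.card_univ, Fintype.card_fin,
          Finset.sum_range_succ']
        simp [g]
    _ ≤ ∑ k ∈ Finset.range n, r ^ (k + 1) := Finset.sum_le_sum fun k _ => hterm k
    _ = (∑ k ∈ Finset.range n, r ^ k) * r := by simp_rw [pow_succ, Finset.sum_mul]
    _ ≤ 2 * r := by
        gcongr
        rw [geom_sum_eq (by linarith), ← neg_div_neg_eq, div_le_iff₀ (by linarith)]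
        linarith [pow_pos hr0 n]

end DepRandomGraph

/-- **Connectivity, upper threshold.** If `f(n) → ∞` and `p(n) > (d(n)+1)(ln n + f(n))/n`,
then any sequence of `d(n)`-dependent random graph distributions is almost surely connected. -/
theorem connectivity_upper (f : ℕ → ℝ) (hf : Tendsto f atTop atTop)
    (p : ℕ → ℝ) (d : ℕ → ℕ)
    (hp : ∀ n : ℕ, p n > ((d n : ℝ) + 1) * (Real.log n + f n) / n)
    (G : (n : ℕ) → DepRandomGraph n (p n) (d n)) :
    Tendsto (fun n : ℕ => (G n).μ {ω | ((G n).graph ω).Connected}) atTop (nhds 1) := by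
  have hr : Tendsto (fun n => Real.exp (2 - f n / 2)) atTop (nhds 0) := by
    refine Real.tendsto_exp_atBot.comp ?_
    simp_rw [sub_eq_add_neg]
    exact tendsto_atBot_add_const_left _ _
      (tendsto_neg_atTop_atBot.comp (hf.atTop_div_const two_pos))
  have hlow : Tendsto (fun n => ENNReal.ofReal (1 - 2 * Real.exp (2 - f n / 2)))
      atTop (nhds 1) := by
    simpa using ENNReal.tendsto_ofReal ((hr.const_mul 2).const_sub 1)
  refine tendsto_of_tendsto_of_tendsto_of_le_of_le' hlow tendsto_const_nhds ?_
    (.of_forall fun n => prob_le_one)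
  filter_upwards [hf.eventually_ge_atTop 0, eventually_gt_atTop 0,
    hr.eventually_le_const (by norm_num : (0 : ℝ) < 1 / 2)] with n hfn hn hrn
  have h := (G n).measureReal_not_connected_le hn hfn (hp n).le hrn
  have hu : (1 : ℝ) ≤ (G n).μ.real {ω | ((G n).graph ω).Connected} +
      (G n).μ.real {ω | ¬ ((G n).graph ω).Connected} := by
    refine le_trans (le_of_eq ?_) (measureReal_union_le _ _)
    rw [← probReal_univ (μ := (G n).μ)]
    congr 1
    ext ω
    simp [em]
  rw [← ofReal_measureReal]
  exact ENNReal.ofReal_le_ofReal (by linarith)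
end
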